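/- Let ν = 0, κ > 0 and γ ∈ [1,2], and suppose θ_0 and S are mean-zero analytic functions. Set α > (d+2)/2 + (1−γ) and β = 1 − (1/α)[(d+2)/2 + (1−γ)]. There exists ε > 0 depending on κ such that if ‖θ_0‖_{L²}^β ‖θ_0‖_{H^α}^{1−β} + ‖θ_0‖_{L²}^β ‖S‖_{H^{α−γ/2}}^{1−β} ≤ ε and ‖Λ^α θ_0‖²_{L²} + (2/κ²)‖S‖²_{H^{α−γ/2}} ≤ ε, then the local-in-time analytic solution of the forced active scalar equation extends to a global-in-time analytic solution. -/

import Mathlib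

open scoped BigOperators

noncomputable section

/-- Fourier coefficients of a (distributional) function on the `d`-dimensional torus
`𝕋^d = [0,2π]^d`. -/
abbrev TorusCoeffs (d : ℕ) := (Fin d → ℤ) → ℂ

namespace ActiveScalar

variable {d : ℕ}

/-- Euclidean length of a frequency vector `k ∈ ℤ^d`. -/
def freqNorm (k : Fin d → ℤ) : ℝ := Real.sqrt (∑ i, ((k i : ℝ)) ^ 2)

/-- Zero mean over the torus. -/
def MeanZero (f : TorusCoeffs d) : Prop := f 0 = 0

/-- The function on the torus represented by the Fourier coefficients `f`. -/
def toFun (f : TorusCoeffs d) (x : Fin d → ℝ) : ℂ :=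
  ∑' k : Fin d → ℤ, f k * Complex.exp (Complex.I * ∑ i, (k i : ℂ) * (x i : ℂ))

/-- Square of the `L²` norm (by Parseval, up to a fixed constant). -/
def l2NormSq (f : TorusCoeffs d) : ℝ := ∑' k : Fin d → ℤ, ‖f k‖ ^ 2

def l2Norm (f : TorusCoeffs d) : ℝ := Real.sqrt (l2NormSq f)

/-- Square of the inhomogeneous Sobolev `H^s` norm. -/
def sobolevNormSq (s : ℝ) (f : TorusCoeffs d) : ℝ :=
  ∑' k : Fin d → ℤ, (1 + freqNorm k ^ 2) ^ s * ‖f k‖ ^ 2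

def sobolevNorm (s : ℝ) (f : TorusCoeffs d) : ℝ := Real.sqrt (sobolevNormSq s f)

/-- Membership in the Sobolev space `H^s`. -/
def InHs (s : ℝ) (f : TorusCoeffs d) : Prop :=
  Summable (fun k : Fin d → ℤ => (1 + freqNorm k ^ 2) ^ s * ‖f k‖ ^ 2)

/-- `C^∞` smoothness: membership in every Sobolev space. -/
def SmoothFn (f : TorusCoeffs d) : Prop := ∀ s : ℝ, InHs s f

/-- Square of the homogeneous norm `‖Λ^s f‖_{L²}`, `Λ = (-Δ)^{1/2}`. -/
def lambdaNormSq (s : ℝ) (f : TorusCoeffs d) : ℝ :=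
  ∑' k : Fin d → ℤ, freqNorm k ^ (2 * s) * ‖f k‖ ^ 2

def lambdaNorm (s : ℝ) (f : TorusCoeffs d) : ℝ := Real.sqrt (lambdaNormSq s f)

/-- Square of the Gevrey norm `‖Λ^r e^{τ Λ^σ} f‖_{L²}` (σ = 1/s gives Gevrey class s;
σ = 1 gives the real-analytic norm with radius of analyticity τ). -/
def gevreyNormSq (σ r τ : ℝ) (f : TorusCoeffs d) : ℝ :=
  ∑' k : Fin d → ℤ, freqNorm k ^ (2 * r) * Real.exp (2 * τ * freqNorm k ^ σ) * ‖f k‖ ^ 2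

def gevreyNorm (σ r τ : ℝ) (f : TorusCoeffs d) : ℝ := Real.sqrt (gevreyNormSq σ r τ f)

/-- Membership in the Gevrey class: finiteness of `‖Λ^r e^{τ Λ^σ} f‖_{L²}`. -/
def InGevrey (σ r τ : ℝ) (f : TorusCoeffs d) : Prop :=
  Summable (fun k : Fin d → ℤ =>
    freqNorm k ^ (2 * r) * Real.exp (2 * τ * freqNorm k ^ σ) * ‖f k‖ ^ 2)

/-- The `L^∞` norm of the function represented by `f`. -/
def linftyNorm (f : TorusCoeffs d) : ℝ := ⨆ x : Fin d → ℝ, ‖toFun f x‖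

/-- Membership in `L^∞`. -/
def InLinfty (f : TorusCoeffs d) : Prop :=
  BddAbove (Set.range fun x : Fin d → ℝ => ‖toFun f x‖)

/-- Hölder seminorm `[f]_{C^α}`. -/
def holderSeminorm (α : ℝ) (f : TorusCoeffs d) : ℝ :=
  ⨆ (x : Fin d → ℝ) (y : Fin d → ℝ) (_ : x ≠ y),
    ‖toFun f x - toFun f y‖ / dist x y ^ α

/-- Hölder norm `‖f‖_{C^α} = ‖f‖_{L^∞} + [f]_{C^α}`. -/
def holderNorm (α : ℝ) (f : TorusCoeffs d) : ℝ := linftyNorm f + holderSeminorm α f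

/-- Membership in the Hölder space `C^α`. -/
def InHolder (α : ℝ) (f : TorusCoeffs d) : Prop :=
  InLinfty f ∧ ∃ C : ℝ, ∀ x y : Fin d → ℝ, x ≠ y →
    ‖toFun f x - toFun f y‖ ≤ C * dist x y ^ α

def setAvgC (s : Set (Fin d → ℝ)) (g : (Fin d → ℝ) → ℂ) : ℂ :=
  MeasureTheory.average (MeasureTheory.volume.restrict s) g

def setAvgR (s : Set (Fin d → ℝ)) (g : (Fin d → ℝ) → ℝ) : ℝ :=
  MeasureTheory.average (MeasureTheory.volume.restrict s) g

/-- BMO seminorm: supremum over balls of the mean oscillation. -/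
def bmoNorm (f : TorusCoeffs d) : ℝ :=
  ⨆ (x : Fin d → ℝ) (r : ℝ) (_ : 0 < r),
    setAvgR (Metric.ball x r) (fun y => ‖toFun f y - setAvgC (Metric.ball x r) (toFun f)‖)

/-- The drift velocity `u_j[θ] = ∂_{x_i} T_{ij}[θ]` determined by Fourier multiplier
symbols `T i j`. -/
def velocity (T : Fin d → Fin d → (Fin d → ℤ) → ℂ) (θ : TorusCoeffs d) (j : Fin d) :
    TorusCoeffs d :=
  fun k => (∑ i : Fin d, Complex.I * (k i : ℂ) * T i j k) * θ k

/-- Fourier coefficients of the advection term `u · ∇θ`. -/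
def advection (u : Fin d → TorusCoeffs d) (θ : TorusCoeffs d) : TorusCoeffs d :=
  fun k => ∑' l : Fin d → ℤ, ∑ j : Fin d, u j (k - l) * (Complex.I * (l j : ℂ)) * θ l

/-- `θ` solves the forced active scalar equation
`∂_t θ + u·∇θ = -κ Λ^γ θ + S`, `u_j = ∂_{x_i} T_{ij}[θ]`, `θ(0) = θ₀`, for times in `I`. -/
def IsSolutionOn (T : Fin d → Fin d → (Fin d → ℤ) → ℂ) (κ γ : ℝ) (S θ₀ : TorusCoeffs d)
    (θ : ℝ → TorusCoeffs d) (I : Set ℝ) : Prop :=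
  θ 0 = θ₀ ∧ ∀ k : Fin d → ℤ, ∀ t ∈ I,
    HasDerivAt (fun τ : ℝ => θ τ k)
      (-(advection (velocity T (θ t)) (θ t) k)
        - Complex.ofReal (κ * freqNorm k ^ γ) * θ t k + S k) t

/-- Assumptions A1–A5 on the family of Fourier multiplier operators `{T^ν_{ij}}_{ν ≥ 0}`. -/
structure SymbolAssumptions (d : ℕ) (T : ℝ → Fin d → Fin d → (Fin d → ℤ) → ℂ) : Prop where
  /-- A1: `∂_{x_i} ∂_{x_j} T^ν_{ij} f = 0` (so the velocity is divergence-free). -/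
  a1 : ∀ ν ≥ (0:ℝ), ∀ k : Fin d → ℤ,
    (∑ i : Fin d, ∑ j : Fin d, (k i : ℂ) * (k j : ℂ) * T ν i j k) = 0
  /-- A2: `T^ν_{ij} : L^∞ → BMO` bounded uniformly in `ν ≥ 0`. -/
  a2 : ∃ C > (0:ℝ), ∀ ν ≥ (0:ℝ), ∀ i j : Fin d, ∀ f : TorusCoeffs d,
    bmoNorm (fun k => T ν i j k * f k) ≤ C * linftyNorm f
  /-- A3: for ν > 0 the symbols decay like `|k|^{-3}`. -/
  a3 : ∀ ν > (0:ℝ), ∃ C > (0:ℝ), ∀ i j : Fin d, ∀ k : Fin d → ℤ, k ≠ 0 →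
    ‖T ν i j k‖ ≤ C * freqNorm k ^ (-3 : ℝ)
  /-- A4: the zero mode vanishes. -/
  a4 : ∀ ν ≥ (0:ℝ), ∀ i j : Fin d, T ν i j 0 = 0
  /-- A5: symbols bounded uniformly for `ν ∈ [0,1]`. -/
  a5 : ∃ C > (0:ℝ), ∀ ν ∈ Set.Icc (0:ℝ) 1, ∀ i j : Fin d, ∀ k : Fin d → ℤ, k ≠ 0 →
    ‖T ν i j k‖ ≤ C

/-- Assumptions on the (singular, order one) operators `T^0_{ij}` at `ν = 0`:
divergence-free velocity, vanishing zero mode, symbols bounded by `C₀`. -/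
structure SymbolAssumptions0 (d : ℕ) (T : Fin d → Fin d → (Fin d → ℤ) → ℂ) (C₀ : ℝ) :
    Prop where
  a1 : ∀ k : Fin d → ℤ, (∑ i : Fin d, ∑ j : Fin d, (k i : ℂ) * (k j : ℂ) * T i j k) = 0
  a4 : ∀ i j : Fin d, T i j 0 = 0
  a5 : ∀ i j : Fin d, ∀ k : Fin d → ℤ, k ≠ 0 → ‖T i j k‖ ≤ C₀

/-- `H^1` distance between two functions. -/
def distH1 (f g : TorusCoeffs d) : ℝ := sobolevNorm 1 (f - g)

/-- `L²` distance between two functions. -/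
def distL2 (f g : TorusCoeffs d) : ℝ := l2Norm (f - g)

/-- The phase space: mean-zero elements of `H^1`. -/
def PhaseH1 (d : ℕ) : Set (TorusCoeffs d) := {f | MeanZero f ∧ InHs 1 f}

/-- Boundedness in `H^1`. -/
def BoundedH1 (B : Set (TorusCoeffs d)) : Prop := ∃ R : ℝ, ∀ f ∈ B, sobolevNorm 1 f ≤ R

/-- Boundedness in `L²`. -/
def BoundedL2 (B : Set (TorusCoeffs d)) : Prop := ∃ R : ℝ, ∀ f ∈ B, l2Norm f ≤ R

/-- `π` is the solution (semigroup) map of the active scalar equation on the `H^1`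
phase space. -/
def IsSolutionMap (T : Fin d → Fin d → (Fin d → ℤ) → ℂ) (κ γ : ℝ) (S : TorusCoeffs d)
    (π : ℝ → TorusCoeffs d → TorusCoeffs d) : Prop :=
  (∀ f, π 0 f = f) ∧
  (∀ s ≥ (0:ℝ), ∀ t ≥ (0:ℝ), ∀ f ∈ PhaseH1 d, π (s + t) f = π s (π t f)) ∧
  (∀ f ∈ PhaseH1 d, IsSolutionOn T κ γ S f (fun t => π t f) (Set.Ici 0))

/-- Sequential compactness with respect to a distance function `ρ`. -/
def SeqCompactWith (ρ : TorusCoeffs d → TorusCoeffs d → ℝ) (G : Set (TorusCoeffs d)) :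
    Prop :=
  ∀ u : ℕ → TorusCoeffs d, (∀ n, u n ∈ G) →
    ∃ g ∈ G, ∃ φ : ℕ → ℕ, StrictMono φ ∧
      Filter.Tendsto (fun n => ρ (u (φ n)) g) Filter.atTop (nhds 0)

/-- Compactness in `H^1` (sequential form). -/
def SeqCompactH1 (G : Set (TorusCoeffs d)) : Prop := SeqCompactWith distH1 G

/-- Compactness in `L²` (sequential form). -/
def SeqCompactL2 (G : Set (TorusCoeffs d)) : Prop := SeqCompactWith distL2 G

/-- `G` attracts all `H^1`-bounded subsets of the phase space, in the `H^1`
Hausdorff semidistance. -/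
def AttractsH1 (π : ℝ → TorusCoeffs d → TorusCoeffs d) (G : Set (TorusCoeffs d)) : Prop :=
  ∀ B : Set (TorusCoeffs d), B ⊆ PhaseH1 d → BoundedH1 B →
    ∀ ε > (0:ℝ), ∃ t₀ : ℝ, ∀ t ≥ t₀, ∀ f ∈ B, ∃ g ∈ G, distH1 (π t f) g < ε

/-- Global attractor in `H^1`: nonempty, compact, invariant, attracting all bounded sets. -/
def IsGlobalAttractorH1 (π : ℝ → TorusCoeffs d → TorusCoeffs d)
    (G : Set (TorusCoeffs d)) : Prop :=
  G.Nonempty ∧ G ⊆ PhaseH1 d ∧ SeqCompactH1 G ∧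
    (∀ t ≥ (0:ℝ), π t '' G = G) ∧ AttractsH1 π G

/-- `B` is an absorbing set for `π` on the `H^1` phase space. -/
def IsAbsorbingH1 (π : ℝ → TorusCoeffs d → TorusCoeffs d) (B : Set (TorusCoeffs d)) :
    Prop :=
  ∀ B' : Set (TorusCoeffs d), B' ⊆ PhaseH1 d → BoundedH1 B' →
    ∃ t₀ : ℝ, ∀ t ≥ t₀, ∀ f ∈ B', π t f ∈ B

/-- Minimal number of `ε`-balls (in `H^1`) needed to cover `G`. -/
def coverNum (G : Set (TorusCoeffs d)) (ε : ℝ) : ℕ :=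
  sInf {n : ℕ | ∃ c : Finset (TorusCoeffs d), c.card = n ∧
    ∀ f ∈ G, ∃ g ∈ c, distH1 f g ≤ ε}

/-- The fractal (box-counting) dimension of `G` in `H^1` is at most `D`:
`limsup_{ε→0⁺} log N(G,ε) / (-log ε) ≤ D`. -/
def FractalDimLe (G : Set (TorusCoeffs d)) (D : ℝ) : Prop :=
  ∀ D' > D, ∀ᶠ ε in nhdsWithin (0:ℝ) (Set.Ioi 0),
    Real.log (coverNum G ε) ≤ D' * (-Real.log ε)

/-- `G` has finite fractal dimension in `H^1`. -/
def HasFiniteFractalDim (G : Set (TorusCoeffs d)) : Prop := ∃ D : ℝ, FractalDimLe G D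

/-- Continuity in time with values in `H^s`, on the time set `I`. -/
def ContinuousInHs (s : ℝ) (θ : ℝ → TorusCoeffs d) (I : Set ℝ) : Prop :=
  (∀ t ∈ I, InHs s (θ t)) ∧ ∀ t₀ ∈ I,
    Filter.Tendsto (fun t => sobolevNorm s (θ t - θ t₀)) (nhdsWithin t₀ I) (nhds 0)

/-- `θ ∈ L²(I; H^s)`. -/
def L2InTimeHs (s : ℝ) (θ : ℝ → TorusCoeffs d) (I : Set ℝ) : Prop :=
  MeasureTheory.IntegrableOn (fun t => (sobolevNorm s (θ t)) ^ 2) I ∧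
    ∀ᵐ t ∂(MeasureTheory.volume.restrict I), InHs s (θ t)

/-- (Real) `H^1` inner product, `⟨f,g⟩_{H^1}`. -/
def h1InnerR (f g : TorusCoeffs d) : ℝ :=
  ((2 * Real.pi) ^ d) *
    (∑' k : Fin d → ℤ, Complex.ofReal (1 + freqNorm k ^ 2) * (starRingEnd ℂ) (f k) * g k).re

/-- The linearized operator `A_θ[ψ] = -κΛ^γψ - u[θ]·∇ψ - u[ψ]·∇θ`. -/
def linOp (T : Fin d → Fin d → (Fin d → ℤ) → ℂ) (κ γ : ℝ) (θ ψ : TorusCoeffs d) :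
    TorusCoeffs d :=
  fun k => -Complex.ofReal (κ * freqNorm k ^ γ) * ψ k
    - advection (velocity T θ) ψ k - advection (velocity T ψ) θ k

/-- The pairing `∫_{𝕋^d} (-Δφ) A_θ[φ] dx` entering the trace `Tr(P_n A_θ)`. -/
def tracePair (T : Fin d → Fin d → (Fin d → ℤ) → ℂ) (κ γ : ℝ) (θ φ : TorusCoeffs d) : ℝ :=
  ((2 * Real.pi) ^ d) *
    (∑' k : Fin d → ℤ, Complex.ofReal (freqNorm k ^ 2) *
      (starRingEnd ℂ) (φ k) * linOp T κ γ θ φ k).re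

/-- One-sided Hausdorff semidistance `sup_{φ∈A} inf_{ψ∈B} ρ(φ,ψ)`. -/
def hausSemidist (ρ : TorusCoeffs d → TorusCoeffs d → ℝ) (A B : Set (TorusCoeffs d)) : ℝ :=
  sSup {c : ℝ | ∃ φ ∈ A, c = sInf {r : ℝ | ∃ ψ ∈ B, r = ρ φ ψ}}

/-! ### The magnetogeostrophic (MG) equation on `𝕋³` -/

/-- `|k|²` for `k ∈ ℤ³`. -/
def mgNormSq (k : Fin 3 → ℤ) : ℝ :=
  ((k 0 : ℝ)) ^ 2 + ((k 1 : ℝ)) ^ 2 + ((k 2 : ℝ)) ^ 2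

/-- Denominator `D(k) = |k|²k₃² + (k₂² + ν|k|⁴)²` of the MG symbols. -/
def mgD (ν : ℝ) (k : Fin 3 → ℤ) : ℝ :=
  mgNormSq k * ((k 2 : ℝ)) ^ 2 + (((k 1 : ℝ)) ^ 2 + ν * mgNormSq k ^ 2) ^ 2

/-- The MG Fourier multiplier symbols `M̂^ν_j(k)` (vanishing on `{k₃ = 0}`). -/
def mgSymbol (ν : ℝ) (j : Fin 3) (k : Fin 3 → ℤ) : ℝ :=
  if k 2 = 0 then 0 else
    (if j = 0 then
        (k 1 : ℝ) * (k 2 : ℝ) * mgNormSq k -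
          (k 0 : ℝ) * (k 2 : ℝ) * (((k 1 : ℝ)) ^ 2 + ν * mgNormSq k ^ 2)
      else if j = 1 then
        -((k 0 : ℝ)) * (k 2 : ℝ) * mgNormSq k -
          (k 1 : ℝ) * (k 2 : ℝ) * (((k 1 : ℝ)) ^ 2 + ν * mgNormSq k ^ 2)
      else
        (((k 0 : ℝ)) ^ 2 + ((k 1 : ℝ)) ^ 2) * (((k 1 : ℝ)) ^ 2 + ν * mgNormSq k ^ 2))
      / mgD ν k

/-- The MG drift velocity `u_j = M^ν_j[θ]`. -/
def mgVelocity (ν : ℝ) (θ : TorusCoeffs 3) (j : Fin 3) : TorusCoeffs 3 :=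
  fun k => (mgSymbol ν j k : ℂ) * θ k

/-- `θ` solves the MG equation `∂_tθ + u·∇θ = κΔθ + S`, `u = M^ν[θ]`, `θ(0) = θ₀`,
for all `t ≥ 0`. -/
def IsMGSolution (ν κ : ℝ) (S θ₀ : TorusCoeffs 3) (θ : ℝ → TorusCoeffs 3) : Prop :=
  θ 0 = θ₀ ∧ ∀ k : Fin 3 → ℤ, ∀ t ≥ (0:ℝ),
    HasDerivAt (fun τ : ℝ => θ τ k)
      (-(advection (mgVelocity ν (θ t)) (θ t) k)
        - Complex.ofReal (κ * freqNorm k ^ 2) * θ t k + S k) t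

/-- Zero vertical mean: Fourier modes with `k₃ = 0` vanish. -/
def VertZero (f : TorusCoeffs 3) : Prop := ∀ k : Fin 3 → ℤ, k 2 = 0 → f k = 0

/-- The MG `H^1` phase space. -/
def MGPhaseH1 : Set (TorusCoeffs 3) := {f | VertZero f ∧ InHs 1 f}

/-- The MG `L²` phase space. -/
def MGPhaseL2 : Set (TorusCoeffs 3) :=
  {f | VertZero f ∧ Summable (fun k : Fin 3 → ℤ => ‖f k‖ ^ 2)}

/-- `π` is the MG solution (semigroup) map for viscosity `ν`. -/
def IsMGSolutionMap (ν κ : ℝ) (S : TorusCoeffs 3)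
    (π : ℝ → TorusCoeffs 3 → TorusCoeffs 3) : Prop :=
  (∀ f, π 0 f = f) ∧
  (∀ s ≥ (0:ℝ), ∀ t ≥ (0:ℝ), ∀ f ∈ MGPhaseL2, π (s + t) f = π s (π t f)) ∧
  (∀ f ∈ MGPhaseL2, IsMGSolution ν κ S f (fun t => π t f))

def MGAttractsH1 (π : ℝ → TorusCoeffs 3 → TorusCoeffs 3) (G : Set (TorusCoeffs 3)) :
    Prop :=
  ∀ B : Set (TorusCoeffs 3), B ⊆ MGPhaseH1 → BoundedH1 B →
    ∀ ε > (0:ℝ), ∃ t₀ : ℝ, ∀ t ≥ t₀, ∀ f ∈ B, ∃ g ∈ G, distH1 (π t f) g < ε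

def MGAttractsL2 (π : ℝ → TorusCoeffs 3 → TorusCoeffs 3) (G : Set (TorusCoeffs 3)) :
    Prop :=
  ∀ B : Set (TorusCoeffs 3), B ⊆ MGPhaseL2 → BoundedL2 B →
    ∀ ε > (0:ℝ), ∃ t₀ : ℝ, ∀ t ≥ t₀, ∀ f ∈ B, ∃ g ∈ G, distL2 (π t f) g < ε

/-- Global attractor of the MG^ν equation in `H^1`. -/
def IsMGAttractorH1 (π : ℝ → TorusCoeffs 3 → TorusCoeffs 3) (G : Set (TorusCoeffs 3)) :
    Prop :=
  G.Nonempty ∧ G ⊆ MGPhaseH1 ∧ SeqCompactH1 G ∧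
    (∀ t ≥ (0:ℝ), π t '' G = G) ∧ MGAttractsH1 π G

/-- Global attractor of the MG⁰ equation in `L²`. -/
def IsMGAttractorL2 (π : ℝ → TorusCoeffs 3 → TorusCoeffs 3) (G : Set (TorusCoeffs 3)) :
    Prop :=
  G.Nonempty ∧ G ⊆ MGPhaseL2 ∧ SeqCompactL2 G ∧
    (∀ t ≥ (0:ℝ), π t '' G = G) ∧ MGAttractsL2 π G

end ActiveScalar

namespace ActiveScalar
variable {d : ℕ}

lemma freqNorm_nonneg (k : Fin d → ℤ) : 0 ≤ freqNorm k := Real.sqrt_nonneg _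

def emb (k : Fin d → ℤ) : EuclideanSpace ℝ (Fin d) := WithLp.toLp 2 (fun i => (k i : ℝ))

lemma norm_emb (k : Fin d → ℤ) : ‖emb k‖ = freqNorm k := by
  simp [emb, EuclideanSpace.norm_eq, freqNorm]

lemma freqNorm_add_le (k l : Fin d → ℤ) : freqNorm (k + l) ≤ freqNorm k + freqNorm l := by
  rw [← norm_emb, ← norm_emb, ← norm_emb]
  have : emb (k + l) = emb k + emb l := by
    ext i; simp [emb]
  rw [this]; exact norm_add_le _ _

lemma freqNorm_sub_add (k l : Fin d → ℤ) : freqNorm k ≤ freqNorm (k - l) + freqNorm l := by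
  simpa using freqNorm_add_le (k - l) l

lemma abs_le_freqNorm (k : Fin d → ℤ) (i : Fin d) : |(k i : ℝ)| ≤ freqNorm k := by
  rw [freqNorm]
  apply Real.le_sqrt_of_sq_le
  rw [sq_abs]
  exact Finset.single_le_sum (f := fun i => ((k i : ℝ)) ^ 2) (fun i _ => sq_nonneg _)
    (Finset.mem_univ i)

@[simp] lemma freqNorm_zero : freqNorm (0 : Fin d → ℤ) = 0 := by simp [freqNorm]

lemma one_le_freqNorm {k : Fin d → ℤ} (hk : k ≠ 0) : 1 ≤ freqNorm k := by
  obtain ⟨i, hi⟩ : ∃ i, k i ≠ 0 := by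
    by_contra! h; exact hk (funext h)
  refine le_trans ?_ (abs_le_freqNorm k i)
  have : (1:ℤ) ≤ |k i| := Int.one_le_abs hi
  exact_mod_cast this

lemma summable_freqNorm_rpow {r : ℝ} (hr : r < -(d:ℝ)) :
    Summable (fun k : Fin d → ℤ => freqNorm k ^ r) := by
  classical
  let b := (EuclideanSpace.basisFun (Fin d) ℝ).toBasis
  let L := Submodule.span ℤ (Set.range b)
  have hfin : Module.finrank ℤ L = d := by
    have := Module.finrank_eq_card_basis (b.restrictScalars ℤ)
    simpa using this
  have hs := ZLattice.summable_norm_rpow L r (by rw [hfin]; exact hr)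
  have hmem : ∀ k : Fin d → ℤ, emb k ∈ L := by
    intro k
    have : emb k = ∑ i, k i • b i := by
      ext j
      simp [emb, b, Finset.sum_apply, Pi.single_apply]
    rw [this]
    exact Submodule.sum_mem _ fun i _ => Submodule.smul_mem _ _ (Submodule.subset_span ⟨i, rfl⟩)
  have hinj : Function.Injective (fun k : Fin d → ℤ => (⟨emb k, hmem k⟩ : L)) := by
    intro k l h
    have h1 : emb k = emb l := congrArg Subtype.val h
    funext i
    have := congrArg (fun v : EuclideanSpace ℝ (Fin d) => v i) h1
    simpa [emb] using this
  have := hs.comp_injective hinj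
  refine this.congr fun k => ?_
  simp [norm_emb]

/-- The terms of the advection sum. -/
def advTerm (T : Fin d → Fin d → (Fin d → ℤ) → ℂ) (θ φ : TorusCoeffs d) (k l : Fin d → ℤ) : ℂ :=
  ∑ j : Fin d, velocity T θ j (k - l) * (Complex.I * (l j : ℂ)) * φ l

lemma advection_eq (T : Fin d → Fin d → (Fin d → ℤ) → ℂ) (θ φ : TorusCoeffs d) (k : Fin d → ℤ) :
    advection (velocity T θ) φ k = ∑' l, advTerm T θ φ k l := rfl

lemma norm_velocity_le {T : Fin d → Fin d → (Fin d → ℤ) → ℂ} {C₀ : ℝ} (hC₀ : 0 < C₀)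
    (hT : SymbolAssumptions0 d T C₀) (θ : TorusCoeffs d) (j : Fin d) (m : Fin d → ℤ) :
    ‖velocity T θ j m‖ ≤ d * C₀ * (freqNorm m * ‖θ m‖) := by
  have hTb : ∀ i, ‖T i j m‖ ≤ C₀ := by
    intro i
    by_cases hm : m = 0
    · rw [hm, hT.a4]; simpa using hC₀.le
    · exact hT.a5 i j m hm
  have h1 : ‖∑ i : Fin d, Complex.I * (m i : ℂ) * T i j m‖ ≤ ∑ _i : Fin d, freqNorm m * C₀ := by
    refine (norm_sum_le _ _).trans (Finset.sum_le_sum fun i _ => ?_)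
    rw [norm_mul, norm_mul, Complex.norm_I, one_mul]
    have : ‖((m i : ℤ) : ℂ)‖ ≤ freqNorm m := by
      rw [Complex.norm_intCast]; exact abs_le_freqNorm m i
    exact mul_le_mul this (hTb i) (norm_nonneg _) (freqNorm_nonneg _)
  rw [velocity, norm_mul]
  calc _ ≤ (∑ _i : Fin d, freqNorm m * C₀) * ‖θ m‖ := by gcongr
    _ = _ := by simp; ring

lemma norm_advTerm_le {T : Fin d → Fin d → (Fin d → ℤ) → ℂ} {C₀ : ℝ} (hC₀ : 0 < C₀)
    (hT : SymbolAssumptions0 d T C₀) (θ φ : TorusCoeffs d) (k l : Fin d → ℤ) :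
    ‖advTerm T θ φ k l‖ ≤
      (d * d * C₀) * ((freqNorm (k - l) * ‖θ (k - l)‖) * (freqNorm l * ‖φ l‖)) := by
  calc _ ≤ ∑ _j : Fin d, d * C₀ * (freqNorm (k - l) * ‖θ (k - l)‖) * (freqNorm l * ‖φ l‖) := by
        refine (norm_sum_le _ _).trans (Finset.sum_le_sum fun j _ => ?_)
        rw [norm_mul, norm_mul, norm_mul, Complex.norm_I, one_mul, mul_assoc]
        have : ‖((l j : ℤ) : ℂ)‖ ≤ freqNorm l := by
          rw [Complex.norm_intCast]; exact abs_le_freqNorm l j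
        have h2 := norm_velocity_le hC₀ hT θ j (k - l)
        have := freqNorm_nonneg l
        have := freqNorm_nonneg (k - l)
        gcongr
    _ = _ := by simp; ring

lemma advTerm_zero {T : Fin d → Fin d → (Fin d → ℤ) → ℂ} {C₀ : ℝ}
    (hT : SymbolAssumptions0 d T C₀) (θ φ : TorusCoeffs d) (l : Fin d → ℤ) :
    advTerm T θ φ 0 l = 0 := by
  have h := hT.a1 (-l)
  have h2 : advTerm T θ φ 0 l
      = (∑ j : Fin d, ∑ i : Fin d, ((-l) i : ℂ) * ((-l) j : ℂ) * T i j (-l)) * (θ (-l) * φ l) := by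
    simp only [advTerm, velocity, zero_sub, Finset.sum_mul]
    refine Finset.sum_congr rfl fun j _ => Finset.sum_congr rfl fun i _ => ?_
    simp only [Pi.neg_apply, Int.cast_neg]
    linear_combination (-(l i : ℂ) * T i j (-l) * θ (-l) * (l j) * φ l) * Complex.I_sq
  rw [h2, Finset.sum_comm]
  have : (∑ i : Fin d, ∑ j : Fin d, ((-l) i : ℂ) * ((-l) j : ℂ) * T i j (-l)) = 0 := by
    simpa using h
  simp only [this, zero_mul]

lemma advection_zero {T : Fin d → Fin d → (Fin d → ℤ) → ℂ} {C₀ : ℝ}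
    (hT : SymbolAssumptions0 d T C₀) (θ φ : TorusCoeffs d) :
    advection (velocity T θ) φ 0 = 0 := by
  rw [advection_eq]; simp [advTerm_zero hT]

lemma advTerm_sub_left (T : Fin d → Fin d → (Fin d → ℤ) → ℂ) (θ θ' φ : TorusCoeffs d)
    (k l : Fin d → ℤ) :
    advTerm T (θ - θ') φ k l = advTerm T θ φ k l - advTerm T θ' φ k l := by
  simp only [advTerm, velocity, Pi.sub_apply, ← Finset.sum_sub_distrib]
  refine Finset.sum_congr rfl fun j _ => ?_
  ring

lemma advTerm_sub_right (T : Fin d → Fin d → (Fin d → ℤ) → ℂ) (θ φ φ' : TorusCoeffs d)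
    (k l : Fin d → ℤ) :
    advTerm T θ (φ - φ') k l = advTerm T θ φ k l - advTerm T θ φ' k l := by
  simp only [advTerm, Pi.sub_apply, ← Finset.sum_sub_distrib]
  refine Finset.sum_congr rfl fun j _ => ?_
  ring

/-- convolution -/
def conv (a b : (Fin d → ℤ) → ℝ) (k : Fin d → ℤ) : ℝ := ∑' l, a (k - l) * b l

def shear : (Fin d → ℤ) × (Fin d → ℤ) ≃ (Fin d → ℤ) × (Fin d → ℤ) where
  toFun := fun p => (p.1 - p.2, p.2)
  invFun := fun p => (p.1 + p.2, p.2)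
  left_inv := fun p => by simp
  right_inv := fun p => by simp

lemma conv_facts {a b : (Fin d → ℤ) → ℝ} (ha0 : ∀ k, 0 ≤ a k) (hb0 : ∀ k, 0 ≤ b k)
    (ha : Summable a) (hb : Summable b) :
    (∀ k, Summable fun l => a (k - l) * b l) ∧ Summable (conv a b) ∧
      ∑' k, conv a b k = (∑' k, a k) * ∑' k, b k := by
  have h1 : Summable fun p : (Fin d → ℤ) × (Fin d → ℤ) => a p.1 * b p.2 :=
    ha.mul_of_nonneg hb ha0 hb0
  have h2 : Summable fun p : (Fin d → ℤ) × (Fin d → ℤ) => a (p.1 - p.2) * b p.2 :=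
    (shear.summable_iff (f := fun p : (Fin d → ℤ) × (Fin d → ℤ) => a p.1 * b p.2)).2 h1
  have h3 : ∀ k, Summable fun l => a (k - l) * b l := fun k => h2.prod_factor k
  refine ⟨h3, h2.prod, ?_⟩
  rw [ha.tsum_mul_tsum hb h1]
  have h4 := (shear (d := d)).tsum_eq (fun p : (Fin d → ℤ) × (Fin d → ℤ) => a p.1 * b p.2)
  rw [← h4]
  exact (h2.tsum_prod).symm

end ActiveScalar

namespace ActiveScalar

lemma intervalIntegrable_exp_mul_rpow {μ q t : ℝ} (hq1 : q < 1) :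
    IntervalIntegrable (fun s => Real.exp (-μ * (t - s)) * s ^ (-q)) MeasureTheory.volume 0 t := by
  apply IntervalIntegrable.continuousOn_mul
  · exact intervalIntegral.intervalIntegrable_rpow' (by linarith)
  · fun_prop

/-- Singular Duhamel estimate. -/
lemma singular_duhamel {μ q t : ℝ} (hμ : 0 < μ) (hq0 : 0 ≤ q) (hq1 : q < 1) (ht : 0 ≤ t) :
    ∫ s in (0:ℝ)..t, Real.exp (-μ * (t - s)) * s ^ (-q) ≤ (1 + 1 / (1 - q)) * μ ^ (q - 1) := by
  set m := min t μ⁻¹ with hm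
  have hm0 : 0 ≤ m := le_min ht (inv_nonneg.2 hμ.le)
  have hmt : m ≤ t := min_le_left _ _
  have hInt := intervalIntegrable_exp_mul_rpow (μ := μ) (t := t) hq1
  have hInt1 : IntervalIntegrable (fun s => Real.exp (-μ * (t - s)) * s ^ (-q))
      MeasureTheory.volume 0 m := hInt.mono_set (by
        rw [Set.uIcc_of_le hm0, Set.uIcc_of_le ht]; exact Set.Icc_subset_Icc_right hmt)
  have hInt2 : IntervalIntegrable (fun s => Real.exp (-μ * (t - s)) * s ^ (-q))
      MeasureTheory.volume m t := hInt.mono_set (by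
        rw [Set.uIcc_of_le hmt, Set.uIcc_of_le ht]; exact Set.Icc_subset_Icc_left hm0)
  rw [← intervalIntegral.integral_add_adjacent_intervals hInt1 hInt2]
  have h1 : ∫ s in (0:ℝ)..m, Real.exp (-μ * (t - s)) * s ^ (-q) ≤ 1 / (1 - q) * μ ^ (q - 1) := by
    calc _ ≤ ∫ s in (0:ℝ)..m, s ^ (-q) := by
          refine intervalIntegral.integral_mono_on hm0 hInt1
            (intervalIntegral.intervalIntegrable_rpow' (by linarith)) fun s hs => ?_
          have : Real.exp (-μ * (t - s)) ≤ 1 := by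
            rw [Real.exp_le_one_iff]; nlinarith [hs.2]
          have h2 := Real.rpow_nonneg hs.1 (-q)
          nlinarith
      _ = m ^ (1 - q) / (1 - q) := by
          rw [integral_rpow (Or.inl (by linarith)), Real.zero_rpow (by linarith)]
          rw [show -q + 1 = 1 - q by ring]; simp
      _ ≤ (μ⁻¹) ^ (1 - q) / (1 - q) := by
          have : 0 < 1 - q := by linarith
          gcongr
          exact min_le_right _ _
      _ = _ := by
          rw [Real.inv_rpow hμ.le, ← Real.rpow_neg hμ.le]
          rw [show -(1 - q) = q - 1 by ring]; ring
  have h2 : ∫ s in m..t, Real.exp (-μ * (t - s)) * s ^ (-q) ≤ μ ^ (q - 1) := by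
    have hcont : Continuous fun s => Real.exp (-μ * (t - s)) * μ ^ q := by fun_prop
    calc _ ≤ ∫ s in m..t, Real.exp (-μ * (t - s)) * μ ^ q := by
          refine intervalIntegral.integral_mono_on_of_le_Ioo hmt hInt2
            (hcont.intervalIntegrable _ _) fun s hs => ?_
          gcongr
          have hms : μ⁻¹ ≤ s := by
            rcases min_choice t μ⁻¹ with h | h
            · have h1 := hs.1
              have h2 := hs.2
              rw [hm, h] at h1
              linarith
            · have h1 := hs.1
              rw [hm, h] at h1; exact h1.le
          have hs0 : 0 < s := lt_of_lt_of_le (inv_pos.2 hμ) hms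
          rw [Real.rpow_neg hs0.le, ← Real.inv_rpow hs0.le]
          apply Real.rpow_le_rpow (inv_nonneg.2 hs0.le) _ hq0
          exact inv_le_of_inv_le₀ hμ hms
      _ = (1 - Real.exp (-μ * (t - m))) / μ * μ ^ q := by
          have hd : ∀ s ∈ Set.uIcc m t, HasDerivAt
              (fun s => Real.exp (-μ * (t - s)) / μ * μ ^ q) (Real.exp (-μ * (t - s)) * μ ^ q) s := by
            intro s _
            have h1 : HasDerivAt (fun s : ℝ => -μ * (t - s)) (-μ * (-1)) s :=
              ((hasDerivAt_id s).const_sub t).const_mul (-μ)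
            have := ((h1.exp).div_const μ).mul_const (μ ^ q)
            refine this.congr_deriv ?_
            rw [neg_mul_neg, mul_one, mul_div_assoc, div_self hμ.ne', mul_one]
          rw [intervalIntegral.integral_eq_sub_of_hasDerivAt hd (hcont.intervalIntegrable _ _)]
          simp; ring
      _ ≤ 1 / μ * μ ^ q := by
          gcongr
          linarith [Real.exp_pos (-μ * (t - m))]
      _ = _ := by rw [Real.rpow_sub hμ, Real.rpow_one]; ring
  linarith

/-- The time weight. -/
def om (p η t : ℝ) : ℝ := (min 1 (max t 0)) ^ p + η

lemma om_cont {p : ℝ} (hp : 0 ≤ p) (η : ℝ) : Continuous (om p η) := by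
  unfold om
  have : Continuous fun t : ℝ => min 1 (max t 0) := by fun_prop
  exact (this.rpow_const fun _ => Or.inr hp).add continuous_const

lemma om_ge (p η t : ℝ) : η ≤ om p η t := by
  have : 0 ≤ (min 1 (max t 0)) ^ p := by positivity
  unfold om; linarith

lemma om_le {p η t : ℝ} (hp : 0 ≤ p) (hη : η ≤ 1) : om p η t ≤ 2 := by
  have : (min 1 (max t 0)) ^ p ≤ 1 :=
    Real.rpow_le_one (by positivity) (min_le_left _ _) hp
  unfold om; linarith

lemma om_sub {p η s t : ℝ} (hp : 0 ≤ p) (hp1 : p ≤ 1) (hs : 0 ≤ s) (hst : s ≤ t) :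
    om p η t ≤ om p η s + (t - s) ^ p := by
  have h1 : (min 1 (max t 0)) ^ p ≤ (min 1 (max s 0) + (t - s)) ^ p := by
    apply Real.rpow_le_rpow (by positivity) _ hp
    rw [max_eq_left hs, max_eq_left (hs.trans hst)]
    rcases min_choice 1 s with h | h
    · rw [h]; linarith [min_le_left 1 t]
    · rw [h]; linarith [min_le_right 1 t]
  have h2 := Real.rpow_add_le_add_rpow (a := min 1 (max s 0)) (b := t - s)
    (by positivity) (by linarith) hp hp1
  unfold om; linarith

lemma om_inv {p η s n : ℝ} (_hp : 0 ≤ p) (hη : 0 < η) (hs : 0 < s) (hn : 0 ≤ n) :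
    (om p η s) ^ (-n) ≤ 1 + s ^ (-(n * p)) := by
  have hmin : 0 < min 1 (max s 0) := by
    rw [max_eq_left hs.le]; exact lt_min one_pos hs
  have h0 : 0 < (min 1 (max s 0)) ^ p := by positivity
  have h1 : (om p η s) ^ (-n) ≤ ((min 1 (max s 0)) ^ p) ^ (-n) := by
    apply Real.rpow_le_rpow_of_nonpos h0 _ (by linarith)
    unfold om; linarith
  refine h1.trans ?_
  rw [← Real.rpow_mul hmin.le, max_eq_left hs.le]
  have hp2 := Real.rpow_pos_of_pos hs (-(n * p))
  rcases min_choice 1 s with h | h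
  · rw [h, Real.one_rpow]; linarith
  · rw [h, show p * -n = -(n * p) by ring]; linarith

lemma rpow_mul_exp_le {p lam r : ℝ} (hp : 0 ≤ p) (hp1 : p ≤ 1) (hl : 0 < lam) (hr : 0 ≤ r) :
    r ^ p * Real.exp (-(lam / 2) * r) ≤ 2 * lam ^ (-p) := by
  have h1 : (lam * r) ^ p ≤ 2 * Real.exp ((lam / 2) * r) := by
    have hx : 0 ≤ lam * r := by positivity
    have h2 : (lam * r) ^ p ≤ 1 + lam * r := by
      rcases le_total (lam * r) 1 with h | h
      · have := Real.rpow_le_one hx h hp; linarith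
      · have := Real.rpow_le_rpow_of_exponent_le h hp1
        rw [Real.rpow_one] at this; linarith
    have := Real.add_one_le_exp ((lam / 2) * r)
    linarith
  rw [Real.mul_rpow hl.le hr] at h1
  rw [Real.rpow_neg hl.le]
  have hlp : 0 < lam ^ p := by positivity
  have he : Real.exp (-(lam / 2) * r) = (Real.exp ((lam / 2) * r))⁻¹ := by
    rw [← Real.exp_neg]; ring_nf
  rw [he, ← div_eq_mul_inv, ← div_eq_mul_inv, div_le_div_iff₀ (Real.exp_pos _) hlp]
  linarith

lemma time_estimate {p κ : ℝ} (hp : 0 ≤ p) (hp1 : p < 1 / 2) (hκ : 0 < κ) :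
    ∃ C > (0:ℝ), ∀ η > (0:ℝ), ∀ lam ≥ κ, ∀ t ≥ (0:ℝ),
      om p η t * ∫ s in (0:ℝ)..t, Real.exp (-lam * (t - s)) * (om p η s) ^ (-2 : ℝ)
        ≤ C * lam ^ (p - 1) := by
  have hκp : 0 < κ ^ (-p) := by positivity
  have hκ2p : 0 < κ ^ (-(2*p)) := by positivity
  have h1p : 0 < 1 - p := by linarith
  have h12p : 0 < 1 - 2 * p := by linarith
  refine ⟨2 * (2 * κ ^ (-p)) + 2 * (1 + 1 / (1 - p)) +
    2 * (2 * (2 * κ ^ (-(2*p)))) + 2 * (2 * (1 + 1 / (1 - 2 * p))), by positivity, ?_⟩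
  intro η hη lam hlam t ht
  have hl : 0 < lam := lt_of_lt_of_le hκ hlam
  set μ := lam / 2 with hμdef
  have hμ : 0 < μ := by positivity
  have i0 := intervalIntegrable_exp_mul_rpow (μ := μ) (t := t) (q := 0) (by norm_num)
  have i1 := intervalIntegrable_exp_mul_rpow (μ := μ) (t := t) (q := p) (by linarith)
  have i2 := intervalIntegrable_exp_mul_rpow (μ := μ) (t := t) (q := 2 * p) (by linarith)
  have j0 := singular_duhamel (μ := μ) (t := t) (q := 0) hμ le_rfl (by norm_num) ht
  have j1 := singular_duhamel (μ := μ) (t := t) (q := p) hμ hp (by linarith) ht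
  have j2 := singular_duhamel (μ := μ) (t := t) (q := 2 * p) hμ (by linarith) (by linarith) ht
  have hom : ∀ s, 0 < om p η s := fun s => lt_of_lt_of_le hη (om_ge p η s)
  have hcontL : Continuous fun s =>
      om p η t * (Real.exp (-lam * (t - s)) * (om p η s) ^ (-2 : ℝ)) := by
    have : Continuous fun s => (om p η s) ^ (-2 : ℝ) :=
      (om_cont hp η).rpow_const fun s => Or.inl (hom s).ne'
    fun_prop
  rw [← intervalIntegral.integral_const_mul]
  set c := 2 * lam ^ (-p) with hc
  have hc0 : 0 < c := by positivity
  have key : ∫ s in (0:ℝ)..t, om p η t * (Real.exp (-lam * (t - s)) * (om p η s) ^ (-2 : ℝ)) ≤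
      ∫ s in (0:ℝ)..t, ((Real.exp (-μ * (t - s)) * s ^ (-(0:ℝ)) + Real.exp (-μ * (t - s)) * s ^ (-p))
        + c * (Real.exp (-μ * (t - s)) * s ^ (-(0:ℝ)) + Real.exp (-μ * (t - s)) * s ^ (-(2*p)))) := by
    refine intervalIntegral.integral_mono_on_of_le_Ioo ht (hcontL.intervalIntegrable _ _)
      ((i0.add i1).add ((i0.add i2).const_mul c)) fun s hs => ?_
    have hs0 := hs.1
    have hr : 0 ≤ t - s := by linarith [hs.2]
    have e1 := om_sub (η := η) hp (by linarith : p ≤ 1) hs0.le hs.2.le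
    have e2 := om_inv (n := 1) hp hη hs0 (by norm_num)
    have e3 := om_inv (n := 2) hp hη hs0 (by norm_num)
    have e4 := rpow_mul_exp_le hp (by linarith : p ≤ 1) hl hr
    rw [← hμdef, ← hc] at e4
    have e5 : Real.exp (-lam * (t - s)) = Real.exp (-μ * (t - s)) * Real.exp (-μ * (t - s)) := by
      rw [← Real.exp_add]; congr 1; rw [hμdef]; ring
    have e6 : Real.exp (-μ * (t - s)) ≤ 1 := by
      rw [Real.exp_le_one_iff]; nlinarith
    have e7 : om p η s * om p η s ^ (-2:ℝ) = om p η s ^ (-1:ℝ) := by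
      rw [← Real.rpow_one_add' (hom s).le (by norm_num)]; norm_num
    have hE := Real.exp_pos (-μ * (t - s))
    have hW : 0 < om p η s ^ (-2:ℝ) := by have := hom s; positivity
    have hV : 0 < om p η s ^ (-1:ℝ) := by have := hom s; positivity
    rw [e5]
    set E := Real.exp (-μ * (t - s))
    set W := om p η s ^ (-2:ℝ)
    set V := om p η s ^ (-1:ℝ)
    rw [one_mul] at e2
    simp only [neg_zero, Real.rpow_zero]
    calc om p η t * (E * E * W) ≤ (om p η s + (t - s) ^ p) * (E * E * W) := by gcongr
      _ = E * (E * V) + ((t - s) ^ p * E) * (E * W) := by rw [← e7]; ring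
      _ ≤ 1 * (E * (1 + s ^ (-p))) + c * (E * (1 + s ^ (-(2 * p)))) := by gcongr
      _ = _ := by ring
  refine key.trans ?_
  rw [intervalIntegral.integral_add (i0.add i1) ((i0.add i2).const_mul c),
    intervalIntegral.integral_add i0 i1, intervalIntegral.integral_const_mul,
    intervalIntegral.integral_add i0 i2]
  have b0 : μ ^ ((0:ℝ) - 1) = 2 * lam ^ (-1:ℝ) := by
    rw [zero_sub, Real.rpow_neg_one, Real.rpow_neg_one, hμdef]; field_simp
  have bq : ∀ q : ℝ, 0 ≤ q → μ ^ (q - 1) ≤ 2 * lam ^ (q - 1) := by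
    intro q hq
    have : μ ^ (q - 1) = lam ^ (q-1) * 2 ^ (1 - q) := by
      rw [hμdef, Real.div_rpow hl.le (by norm_num), div_eq_mul_inv, ← Real.rpow_neg (by norm_num)]
      ring_nf
    rw [this]
    have h2 : (2:ℝ) ^ (1 - q) ≤ 2 := by
      calc (2:ℝ) ^ (1 - q) ≤ 2 ^ (1:ℝ) := Real.rpow_le_rpow_of_exponent_le (by norm_num) (by linarith)
        _ = 2 := by norm_num
    have := Real.rpow_pos_of_pos hl (q - 1)
    nlinarith
  have hX : 0 < lam ^ (p - 1) := by positivity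
  have k1 : lam ^ (-1:ℝ) ≤ κ ^ (-p) * lam ^ (p - 1) := by
    have h1 : lam ^ (-1:ℝ) = lam ^ (-p) * lam ^ (p - 1) := by
      rw [← Real.rpow_add hl]; ring_nf
    rw [h1]
    exact mul_le_mul_of_nonneg_right
      (Real.rpow_le_rpow_of_nonpos hκ hlam (by linarith)) hX.le
  have k2 : lam ^ (-p) * lam ^ (-1:ℝ) ≤ κ ^ (-(2*p)) * lam ^ (p - 1) := by
    have h1 : lam ^ (-p) * lam ^ (-1:ℝ) = lam ^ (-(2*p)) * lam ^ (p - 1) := by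
      rw [← Real.rpow_add hl, ← Real.rpow_add hl]; ring_nf
    rw [h1]
    exact mul_le_mul_of_nonneg_right
      (Real.rpow_le_rpow_of_nonpos hκ hlam (by linarith)) hX.le
  have k3 : lam ^ (-p) * lam ^ (2 * p - 1) = lam ^ (p - 1) := by
    rw [← Real.rpow_add hl]; ring_nf
  rw [b0] at j0
  have q1 := bq p hp
  have q2 := bq (2 * p) (by linarith)
  have g1 : (1 + 1 / (1 - p)) * μ ^ (p - 1) ≤ (1 + 1 / (1 - p)) * (2 * lam ^ (p - 1)) := by gcongr
  have g2 : (1 + 1 / (1 - 2 * p)) * μ ^ (2 * p - 1)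
      ≤ (1 + 1 / (1 - 2 * p)) * (2 * lam ^ (2 * p - 1)) := by gcongr
  have g3 := mul_le_mul_of_nonneg_left (add_le_add j0 (j2.trans g2)) hc0.le
  have g4 : c * ((1 + 1 / (1 - 0)) * (2 * lam ^ (-1:ℝ))
      + (1 + 1 / (1 - 2 * p)) * (2 * lam ^ (2 * p - 1)))
      ≤ 2 * (2 * (2 * κ ^ (-(2*p)))) * lam ^ (p - 1)
        + 2 * (2 * (1 + 1 / (1 - 2 * p))) * lam ^ (p - 1) := by
    have : c * ((1 + 1 / (1 - 0)) * (2 * lam ^ (-1:ℝ))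
      + (1 + 1 / (1 - 2 * p)) * (2 * lam ^ (2 * p - 1)))
      = 8 * (lam ^ (-p) * lam ^ (-1:ℝ))
        + 4 * (1 + 1 / (1 - 2 * p)) * (lam ^ (-p) * lam ^ (2 * p - 1)) := by
      rw [hc]; ring
    rw [this, k3]
    nlinarith
  have g0 : (1 + 1 / (1 - (0:ℝ))) * (2 * lam ^ (-1:ℝ)) ≤ 2 * (2 * κ ^ (-p)) * lam ^ (p - 1) := by
    norm_num; nlinarith
  linarith

end ActiveScalar

namespace ActiveScalar
variable {d : ℕ}

lemma bilin_fixed_point {E : Type*} [NormedAddCommGroup E] [CompleteSpace E]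
    (B : E → E → E) {C : ℝ} (hC : 0 < C) (hB : ∀ x y, ‖B x y‖ ≤ C * (‖x‖ * ‖y‖))
    (hl : ∀ x y z, B (x - y) z = B x z - B y z) (hr : ∀ x y z, B x (y - z) = B x y - B x z)
    (y₀ : E) (hy : 8 * C * ‖y₀‖ ≤ 1) : ∃ x : E, x = y₀ - B x x := by
  set R := 1 / (4 * C) with hR
  have hCR : C * R = 1 / 4 := by rw [hR]; field_simp
  have hR0 : 0 < R := by positivity
  let Φ : E → E := fun x => y₀ - B x x
  let s := Metric.closedBall (0 : E) R
  have hy' : ‖y₀‖ ≤ R / 2 := by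
    have : C * (8 * ‖y₀‖) ≤ C * (4 * R) := by nlinarith
    have := le_of_mul_le_mul_left this hC
    linarith
  have hmaps : Set.MapsTo Φ s s := by
    intro x hx
    simp only [s, Metric.mem_closedBall, dist_zero_right] at hx ⊢
    have h1 : ‖Φ x‖ ≤ ‖y₀‖ + C * (‖x‖ * ‖x‖) := (norm_sub_le _ _).trans (by gcongr; exact hB x x)
    have h2 : C * (‖x‖ * ‖x‖) ≤ C * (R * R) := by gcongr
    nlinarith
  have hlip : ContractingWith (1/2) (hmaps.restrict Φ s s) := by
    refine ⟨by rw [← NNReal.coe_lt_coe]; norm_num, LipschitzWith.of_dist_le_mul fun x y => ?_⟩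
    have hx : ‖(x:E)‖ ≤ R := mem_closedBall_zero_iff.1 x.2
    have hy : ‖(y:E)‖ ≤ R := mem_closedBall_zero_iff.1 y.2
    rw [Subtype.dist_eq, Subtype.dist_eq, dist_eq_norm, dist_eq_norm]
    simp only [Set.MapsTo.val_restrict_apply, Φ]
    have e : y₀ - B x x - (y₀ - B y y) = -(B (x - y) x + B y (x - y)) := by
      rw [hl, hr]; abel
    rw [e, norm_neg]
    have h1 := hB (x - y : E) x
    have h2 := hB y (x - y : E)
    have h3 : C * (‖(x - y : E)‖ * ‖(x:E)‖) ≤ C * (‖(x - y : E)‖ * R) := by gcongr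
    have h4 : C * (‖(y:E)‖ * ‖(x - y : E)‖) ≤ C * (R * ‖(x - y : E)‖) := by gcongr
    refine (norm_add_le _ _).trans ?_
    have h5 : (((1/2 : NNReal)) : ℝ) = 1/2 := by norm_num
    rw [h5]
    have h6 : C * (‖(x - y : E)‖ * R) = (C * R) * ‖(x - y : E)‖ := by ring
    have h7 : C * (R * ‖(x - y : E)‖) = (C * R) * ‖(x - y : E)‖ := by ring
    rw [hCR] at h6 h7
    linarith
  obtain ⟨x, -, hfix, -⟩ := ContractingWith.exists_fixedPoint' (x := (0:E))
    Metric.isClosed_closedBall.isComplete hmaps hlip (by simp [s, hR0.le]) (edist_ne_top _ _)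
  exact ⟨x, hfix.symm⟩

/-- Duhamel integral. -/
def duh (lam : ℝ) (g : ℝ → ℂ) (t : ℝ) : ℂ :=
  ∫ s in (0:ℝ)..(max t 0), (Real.exp (-lam * (max t 0 - s)) : ℂ) * g s

lemma duh_eq (lam : ℝ) (g : ℝ → ℂ) (t : ℝ) :
    duh lam g t = (Real.exp (-lam * max t 0) : ℂ) *
      ∫ s in (0:ℝ)..(max t 0), (Real.exp (lam * s) : ℂ) * g s := by
  rw [duh, ← intervalIntegral.integral_const_mul]
  congr 1
  funext s
  rw [← mul_assoc, ← Complex.ofReal_mul, ← Real.exp_add]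
  congr 3; ring

lemma duh_cont (lam : ℝ) {g : ℝ → ℂ} (hg : Continuous g) : Continuous (duh lam g) := by
  have h1 : Continuous fun s : ℝ => (Real.exp (lam * s) : ℂ) * g s := by fun_prop
  have h2 : Continuous fun t => ∫ s in (0:ℝ)..t, (Real.exp (lam * s) : ℂ) * g s :=
    intervalIntegral.continuous_primitive (fun a b => h1.intervalIntegrable a b) 0
  have h3 : Continuous fun t : ℝ => max t 0 := by fun_prop
  have h4 := h2.comp h3
  have h5 : duh lam g = fun t => (Real.exp (-lam * max t 0) : ℂ) *
      ∫ s in (0:ℝ)..(max t 0), (Real.exp (lam * s) : ℂ) * g s := funext fun t => duh_eq lam g t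
  rw [h5]
  have h6 : Continuous fun t : ℝ => (Real.exp (-lam * max t 0) : ℂ) := by fun_prop
  exact h6.mul h4

lemma duh_sub (lam : ℝ) {g h : ℝ → ℂ} (hg : Continuous g) (hh : Continuous h) (t : ℝ) :
    duh lam (fun s => g s - h s) t = duh lam g t - duh lam h t := by
  unfold duh
  rw [← intervalIntegral.integral_sub]
  · congr 1; funext s; ring
  · exact Continuous.intervalIntegrable (by fun_prop) _ _
  · exact Continuous.intervalIntegrable (by fun_prop) _ _

lemma norm_duh_le (lam A : ℝ) {g : ℝ → ℂ} {f : ℝ → ℝ} (hf : Continuous f)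
    (hgf : ∀ s, ‖g s‖ ≤ A * f s) (t : ℝ) :
    ‖duh lam g t‖ ≤ A * ∫ s in (0:ℝ)..(max t 0), Real.exp (-lam * (max t 0 - s)) * f s := by
  rw [← intervalIntegral.integral_const_mul]
  refine intervalIntegral.norm_integral_le_of_norm_le (le_max_right _ _) ?_ ?_
  · refine Filter.Eventually.of_forall fun s _ => ?_
    rw [norm_mul, Complex.norm_real, Real.norm_eq_abs, abs_of_pos (Real.exp_pos _)]
    have := mul_le_mul_of_nonneg_left (hgf s) (Real.exp_pos (-lam * (max t 0 - s))).le
    linarith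
  · exact Continuous.intervalIntegrable (by fun_prop) _ _

/-- The fixed point space. -/
abbrev XS (d : ℕ) := lp (fun _ : (Fin d → ℤ) => BoundedContinuousFunction ℝ ℂ) 1

lemma XS_summable (x : XS d) : Summable fun k => ‖x k‖ := by
  have := (lp.memℓp x).summable (by norm_num)
  simpa using this

lemma XS_norm (x : XS d) : ‖x‖ = ∑' k, ‖x k‖ := by
  rw [lp.norm_eq_tsum_rpow (by norm_num)]
  simp

lemma XS_mk (f : (Fin d → ℤ) → ℝ → ℂ) (hf : ∀ k, Continuous (f k)) (b : (Fin d → ℤ) → ℝ)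
    (hb : Summable b) (hfb : ∀ k t, ‖f k t‖ ≤ b k) :
    ∃ x : XS d, (∀ k t, x k t = f k t) ∧ ‖x‖ ≤ ∑' k, b k := by
  have hb0 : ∀ k, 0 ≤ b k := fun k => (norm_nonneg _).trans (hfb k 0)
  let g : ∀ k : Fin d → ℤ, BoundedContinuousFunction ℝ ℂ := fun k =>
    BoundedContinuousFunction.ofNormedAddCommGroup (f k) (hf k) (b k) (hfb k)
  have hg : ∀ k, ‖g k‖ ≤ b k := fun k =>
    BoundedContinuousFunction.norm_ofNormedAddCommGroup_le _ (hb0 k) _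
  have hs : Summable fun k => ‖g k‖ := hb.of_nonneg_of_le (fun _ => norm_nonneg _) hg
  let x : XS d := ⟨g, memℓp_gen (by simpa using hs)⟩
  refine ⟨x, fun k t => rfl, ?_⟩
  rw [XS_norm]
  exact hs.tsum_le_tsum hg hb

/-- Spatial weight. -/
def wt (τ : ℝ) (k : Fin d → ℤ) : ℝ := freqNorm k * Real.exp (τ * freqNorm k)

lemma wt_zero (τ : ℝ) : wt τ (0 : Fin d → ℤ) = 0 := by simp [wt]

lemma wt_pos (τ : ℝ) {k : Fin d → ℤ} (hk : k ≠ 0) : 0 < wt τ k :=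
  mul_pos (lt_of_lt_of_le one_pos (one_le_freqNorm hk)) (Real.exp_pos _)

/-- The unknown recovered from the fixed point variable. -/
def th (p η τ : ℝ) (x : XS d) (t : ℝ) : TorusCoeffs d :=
  fun k => x k t / ((wt τ k * om p η t : ℝ) : ℂ)

lemma th_sub (p η τ : ℝ) (x y : XS d) (t : ℝ) :
    th p η τ (x - y) t = th p η τ x t - th p η τ y t := by
  funext k
  simp [th, sub_div]

lemma th_bound {p η : ℝ} (τ : ℝ) (hη : 0 < η) (x : XS d) (t : ℝ) (m : Fin d → ℤ) :
    freqNorm m * ‖th p η τ x t m‖ ≤ Real.exp (-τ * freqNorm m) * (om p η t)⁻¹ * ‖x m‖ := by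
  have ho : 0 < om p η t := lt_of_lt_of_le hη (om_ge p η t)
  by_cases hm : m = 0
  · subst hm
    simp only [freqNorm_zero, zero_mul]; positivity
  · have h1 := lt_of_lt_of_le one_pos (one_le_freqNorm hm)
    have hx := (x m).norm_coe_le_norm t
    rw [th, norm_div, Complex.norm_real, Real.norm_eq_abs,
      abs_of_pos (mul_pos (wt_pos τ hm) ho), wt, neg_mul, Real.exp_neg]
    have : freqNorm m * (‖x m t‖ / (freqNorm m * Real.exp (τ * freqNorm m) * om p η t))
      = (Real.exp (τ * freqNorm m))⁻¹ * (om p η t)⁻¹ * ‖x m t‖ := by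
      field_simp
    rw [this]
    gcongr

lemma th_cont {p η : ℝ} (τ : ℝ) (hp : 0 ≤ p) (hη : 0 < η) (x : XS d) (m : Fin d → ℤ) :
    Continuous fun t => th p η τ x t m := by
  by_cases hm : m = 0
  · subst hm; simp only [th, wt_zero]; simp; exact continuous_const
  · unfold th
    have h1 := om_cont hp η
    refine (x m).continuous.div (by fun_prop) fun t => ?_
    have ho : 0 < om p η t := lt_of_lt_of_le hη (om_ge p η t)
    exact_mod_cast ne_of_gt (mul_pos (wt_pos τ hm) ho)

/-- The nonlinearity. -/
def nl (T : Fin d → Fin d → (Fin d → ℤ) → ℂ) (p η τ : ℝ) (x y : XS d) (k : Fin d → ℤ) (t : ℝ) : ℂ :=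
  advection (velocity T (th p η τ x t)) (th p η τ y t) k

section nlsec
variable {T : Fin d → Fin d → (Fin d → ℤ) → ℂ} {C₀ : ℝ} {p η τ : ℝ}

lemma nl_term (hC₀ : 0 < C₀) (hT : SymbolAssumptions0 d T C₀) (hη : 0 < η) (hτ : 0 ≤ τ)
    (x y : XS d) (k l : Fin d → ℤ) (t : ℝ) :
    ‖advTerm T (th p η τ x t) (th p η τ y t) k l‖ ≤
      (d * d * C₀ * Real.exp (-τ * freqNorm k)) * (om p η t) ^ (-2:ℝ) * (‖x (k - l)‖ * ‖y l‖) := by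
  refine (norm_advTerm_le hC₀ hT _ _ k l).trans ?_
  have h1 := th_bound (p := p) τ hη x t (k - l)
  have h2 := th_bound (p := p) τ hη y t l
  have ho : 0 < om p η t := lt_of_lt_of_le hη (om_ge p η t)
  have h3 : Real.exp (-τ * freqNorm (k - l)) * Real.exp (-τ * freqNorm l)
      ≤ Real.exp (-τ * freqNorm k) := by
    rw [← Real.exp_add, Real.exp_le_exp]
    nlinarith [freqNorm_sub_add k l]
  have h4 : (om p η t) ^ (-2:ℝ) = (om p η t)⁻¹ * (om p η t)⁻¹ := by
    rw [Real.rpow_neg ho.le]; norm_num; ring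
  have hl := freqNorm_nonneg l
  have hkl := freqNorm_nonneg (k - l)
  calc _ ≤ (d * d * C₀) * ((Real.exp (-τ * freqNorm (k - l)) * (om p η t)⁻¹ * ‖x (k - l)‖) *
        (Real.exp (-τ * freqNorm l) * (om p η t)⁻¹ * ‖y l‖)) := by gcongr
    _ = (d * d * C₀) * (Real.exp (-τ * freqNorm (k - l)) * Real.exp (-τ * freqNorm l)) *
        (om p η t) ^ (-2:ℝ) * (‖x (k - l)‖ * ‖y l‖) := by rw [h4]; ring
    _ ≤ _ := by gcongr

lemma conv_summable (x y : XS d) (k : Fin d → ℤ) : Summable fun l => ‖x (k - l)‖ * ‖y l‖ :=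
  (conv_facts (fun k => norm_nonneg (x k)) (fun k => norm_nonneg (y k)) (XS_summable x)
    (XS_summable y)).1 k

lemma nl_summable (hC₀ : 0 < C₀) (hT : SymbolAssumptions0 d T C₀) (hη : 0 < η) (hτ : 0 ≤ τ)
    (x y : XS d) (k : Fin d → ℤ) (t : ℝ) :
    Summable fun l => advTerm T (th p η τ x t) (th p η τ y t) k l :=
  Summable.of_norm_bounded ((conv_summable x y k).mul_left _)
    fun l => nl_term hC₀ hT hη hτ x y k l t

lemma nl_bound (hC₀ : 0 < C₀) (hT : SymbolAssumptions0 d T C₀) (hη : 0 < η) (hτ : 0 ≤ τ)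
    (x y : XS d) (k : Fin d → ℤ) (t : ℝ) :
    ‖nl T p η τ x y k t‖ ≤ (d * d * C₀ * Real.exp (-τ * freqNorm k) *
      conv (fun k => ‖x k‖) (fun k => ‖y k‖) k) * (om p η t) ^ (-2:ℝ) := by
  rw [nl, advection_eq]
  have h := tsum_of_norm_bounded ((conv_summable x y k).mul_left _).hasSum
    fun l => nl_term (p := p) hC₀ hT hη hτ x y k l t
  refine h.trans (le_of_eq ?_)
  rw [tsum_mul_left, conv]; ring

lemma nl_cont (hC₀ : 0 < C₀) (hT : SymbolAssumptions0 d T C₀) (hp : 0 ≤ p) (hη : 0 < η)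
    (hτ : 0 ≤ τ) (x y : XS d) (k : Fin d → ℤ) : Continuous (nl T p η τ x y k) := by
  have : nl T p η τ x y k = fun t => ∑' l, advTerm T (th p η τ x t) (th p η τ y t) k l := rfl
  rw [this]
  refine continuous_tsum (u := fun l => (d * d * C₀ * Real.exp (-τ * freqNorm k)) * η ^ (-2:ℝ) *
    (‖x (k - l)‖ * ‖y l‖)) (fun l => ?_) ((conv_summable x y k).mul_left _) fun l t => ?_
  · unfold advTerm velocity
    have h1 := th_cont τ hp hη x (k - l)
    have h2 := th_cont τ hp hη y l
    fun_prop
  · refine (nl_term hC₀ hT hη hτ x y k l t).trans ?_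
    have := Real.rpow_le_rpow_of_nonpos hη (om_ge p η t) (by norm_num : (-2:ℝ) ≤ 0)
    gcongr

lemma nl_sub_left (hC₀ : 0 < C₀) (hT : SymbolAssumptions0 d T C₀) (hη : 0 < η) (hτ : 0 ≤ τ)
    (x x' y : XS d) (k : Fin d → ℤ) (t : ℝ) :
    nl T p η τ (x - x') y k t = nl T p η τ x y k t - nl T p η τ x' y k t := by
  simp only [nl, advection_eq]
  rw [← (nl_summable hC₀ hT hη hτ x y k t).tsum_sub (nl_summable hC₀ hT hη hτ x' y k t)]
  simp only [th_sub, advTerm_sub_left]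

lemma nl_sub_right (hC₀ : 0 < C₀) (hT : SymbolAssumptions0 d T C₀) (hη : 0 < η) (hτ : 0 ≤ τ)
    (x y y' : XS d) (k : Fin d → ℤ) (t : ℝ) :
    nl T p η τ x (y - y') k t = nl T p η τ x y k t - nl T p η τ x y' k t := by
  simp only [nl, advection_eq]
  rw [← (nl_summable hC₀ hT hη hτ x y k t).tsum_sub (nl_summable hC₀ hT hη hτ x y' k t)]
  simp only [th_sub, advTerm_sub_right]

/-- The bilinear Duhamel term. -/
def Bf (T : Fin d → Fin d → (Fin d → ℤ) → ℂ) (κ γ p η τ : ℝ) (x y : XS d) (k : Fin d → ℤ)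
    (t : ℝ) : ℂ :=
  ((wt τ k * om p η t : ℝ) : ℂ) * duh (κ * freqNorm k ^ γ) (nl T p η τ x y k) t

lemma om_max (p η t : ℝ) : om p η (max t 0) = om p η t := by simp [om]

lemma Bf_bound (hC₀ : 0 < C₀) (hT : SymbolAssumptions0 d T C₀) {κ γ : ℝ} (hκ : 0 < κ)
    (hγ : 1 ≤ γ) (hp : 0 ≤ p) (hpγ : γ * (p - 1) ≤ -1) {C : ℝ} (hC : 0 < C)
    (hη : 0 < η) (hτ : 0 ≤ τ)
    (hCe : ∀ lam ≥ κ, ∀ t ≥ (0:ℝ),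
      om p η t * ∫ s in (0:ℝ)..t, Real.exp (-lam * (t - s)) * (om p η s) ^ (-2 : ℝ)
        ≤ C * lam ^ (p - 1))
    (x y : XS d) (k : Fin d → ℤ) (t : ℝ) :
    ‖Bf T κ γ p η τ x y k t‖ ≤ (d * d * C₀ * C * κ ^ (p - 1)) *
      conv (fun k => ‖x k‖) (fun k => ‖y k‖) k := by
  have hconv : 0 ≤ conv (fun k => ‖x k‖) (fun k => ‖y k‖) k :=
    tsum_nonneg fun l => by positivity
  by_cases hk : k = 0
  · subst hk
    simp only [Bf, wt_zero]; simp; positivity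
  have hk1 := one_le_freqNorm hk
  have hk0 : 0 < freqNorm k := by linarith
  have ho : ∀ t, 0 < om p η t := fun t => lt_of_lt_of_le hη (om_ge p η t)
  have hlam : κ ≤ κ * freqNorm k ^ γ :=
    le_mul_of_one_le_right hκ.le (Real.one_le_rpow hk1 (by linarith))
  have hcont : Continuous fun s => (om p η s) ^ (-2 : ℝ) :=
      (om_cont hp η).rpow_const fun s => Or.inl (ho s).ne'
  have h1 := norm_duh_le (κ * freqNorm k ^ γ) _ hcont
    (fun s => nl_bound (p := p) hC₀ hT hη hτ x y k s) t
  have h2 := hCe _ hlam (max t 0) (le_max_right _ _)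
  rw [om_max] at h2
  rw [Bf, norm_mul, Complex.norm_real, Real.norm_eq_abs, abs_of_pos (mul_pos (wt_pos τ hk) (ho t))]
  set J := ∫ s in (0:ℝ)..(max t 0), Real.exp (-(κ * freqNorm k ^ γ) * (max t 0 - s)) *
    (om p η s) ^ (-2 : ℝ)
  set V := conv (fun k => ‖x k‖) (fun k => ‖y k‖) k
  have he : Real.exp (τ * freqNorm k) * Real.exp (-τ * freqNorm k) = 1 := by
    rw [← Real.exp_add]; simp
  have hw := wt_pos τ hk
  have hot := ho t
  have h3 : freqNorm k * (κ * freqNorm k ^ γ) ^ (p - 1) ≤ κ ^ (p - 1) := by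
    rw [Real.mul_rpow hκ.le (by positivity), ← Real.rpow_mul hk0.le]
    have : freqNorm k * freqNorm k ^ (γ * (p - 1)) ≤ 1 := by
      calc _ ≤ freqNorm k * freqNorm k ^ (-1:ℝ) := by gcongr
        _ = 1 := by rw [Real.rpow_neg_one]; field_simp
    have hkp : 0 < κ ^ (p - 1) := by positivity
    nlinarith
  calc _ ≤ wt τ k * om p η t * ((d * d * C₀ * Real.exp (-τ * freqNorm k) * V) * J) := by gcongr
    _ = (Real.exp (τ * freqNorm k) * Real.exp (-τ * freqNorm k)) *
        (d * d * C₀ * V) * (freqNorm k * (om p η t * J)) := by rw [wt]; ring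
    _ = (d * d * C₀ * V) * (freqNorm k * (om p η t * J)) := by rw [he, one_mul]
    _ ≤ (d * d * C₀ * V) * (freqNorm k * (C * (κ * freqNorm k ^ γ) ^ (p - 1))) := by gcongr
    _ = (d * d * C₀ * V * C) * (freqNorm k * (κ * freqNorm k ^ γ) ^ (p - 1)) := by ring
    _ ≤ (d * d * C₀ * V * C) * κ ^ (p - 1) := by gcongr
    _ = _ := by ring

lemma Bf_cont (hC₀ : 0 < C₀) (hT : SymbolAssumptions0 d T C₀) (κ γ : ℝ) (hp : 0 ≤ p)
    (hη : 0 < η) (hτ : 0 ≤ τ) (x y : XS d) (k : Fin d → ℤ) :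
    Continuous (Bf T κ γ p η τ x y k) := by
  have h1 := duh_cont (κ * freqNorm k ^ γ) (nl_cont hC₀ hT hp hη hτ x y k)
  have h2 := om_cont hp η
  unfold Bf
  fun_prop

/-- Solve the integral equation. -/
lemma exists_mild (hC₀ : 0 < C₀) (hT : SymbolAssumptions0 d T C₀) {κ γ : ℝ} (hκ : 0 < κ)
    (hγ : 1 ≤ γ) (hp : 0 ≤ p) (hpγ : γ * (p - 1) ≤ -1) {C : ℝ} (hC : 0 < C)
    (hη : 0 < η) (hτ : 0 ≤ τ)
    (hCe : ∀ lam ≥ κ, ∀ t ≥ (0:ℝ),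
      om p η t * ∫ s in (0:ℝ)..t, Real.exp (-lam * (t - s)) * (om p η s) ^ (-2 : ℝ)
        ≤ C * lam ^ (p - 1))
    (y₀ : XS d) (hy : 8 * (d * d * C₀ * C * κ ^ (p - 1) + 1) * ‖y₀‖ ≤ 1) :
    ∃ x : XS d, ∀ k t, x k t = y₀ k t - Bf T κ γ p η τ x x k t := by
  have hM : 0 ≤ d * d * C₀ * C * κ ^ (p - 1) := by positivity
  have hfacts := fun x y : XS d => conv_facts (fun k => norm_nonneg (x k))
    (fun k => norm_nonneg (y k)) (XS_summable x) (XS_summable y)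
  choose B hB1 hB2 using fun x y : XS d => XS_mk (Bf T κ γ p η τ x y)
    (Bf_cont hC₀ hT κ γ hp hη hτ x y) _ ((hfacts x y).2.1.mul_left _)
    (Bf_bound hC₀ hT hκ hγ hp hpγ hC hη hτ hCe x y)
  obtain ⟨x, hx⟩ := bilin_fixed_point B (C := d * d * C₀ * C * κ ^ (p - 1) + 1) (by positivity)
    (fun x y => by
      refine (hB2 x y).trans ?_
      rw [tsum_mul_left, (hfacts x y).2.2, ← XS_norm, ← XS_norm]
      gcongr
      linarith)
    (fun x y z => by
      apply lp.ext; funext k; ext1 t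
      rw [lp.coeFn_sub]
      simp only [Pi.sub_apply, BoundedContinuousFunction.coe_sub, hB1, Bf]
      rw [← mul_sub, ← duh_sub _ (nl_cont hC₀ hT hp hη hτ x z k) (nl_cont hC₀ hT hp hη hτ y z k)]
      congr 2; funext s
      exact nl_sub_left hC₀ hT hη hτ x y z k s)
    (fun x y z => by
      apply lp.ext; funext k; ext1 t
      rw [lp.coeFn_sub]
      simp only [Pi.sub_apply, BoundedContinuousFunction.coe_sub, hB1, Bf]
      rw [← mul_sub, ← duh_sub _ (nl_cont hC₀ hT hp hη hτ x y k) (nl_cont hC₀ hT hp hη hτ x z k)]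
      congr 2; funext s
      exact nl_sub_right hC₀ hT hη hτ x y z k s) y₀ hy
  refine ⟨x, fun k t => ?_⟩
  rw [← hB1 x x k t]
  conv_lhs => rw [hx]
  rw [lp.coeFn_sub]; rfl

end nlsec
end ActiveScalar

namespace ActiveScalar
variable {d : ℕ}
variable {T : Fin d → Fin d → (Fin d → ℤ) → ℂ} {C₀ : ℝ} {p η τ : ℝ}

/-- majorant of the data -/
def dataBound (κ γ p η τ : ℝ) (θ₀ S : TorusCoeffs d) (k : Fin d → ℤ) : ℝ :=
  wt τ k * ((2 * (κ * freqNorm k ^ γ) ^ (-p) + η) * ‖θ₀ k‖ + 4 / (κ * freqNorm k ^ γ) * ‖S k‖)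

/-- linear evolution of the data, weighted -/
def dataFun (κ γ p η τ : ℝ) (θ₀ S : TorusCoeffs d) (k : Fin d → ℤ) (t : ℝ) : ℂ :=
  ((wt τ k * om p η t : ℝ) : ℂ) * ((Real.exp (-(κ * freqNorm k ^ γ) * max t 0) : ℂ) * θ₀ k +
    duh (κ * freqNorm k ^ γ) (fun _ => S k) t)

lemma om_exp_le {lam : ℝ} (hl : 0 < lam) (hp : 0 ≤ p) (hp1 : p ≤ 1) (hη : 0 < η) (t : ℝ) :
    om p η t * Real.exp (-lam * max t 0) ≤ 2 * lam ^ (-p) + η := by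
  have ht : 0 ≤ max t 0 := le_max_right _ _
  have h1 := rpow_mul_exp_le hp hp1 hl ht
  have h2 : (min 1 (max t 0)) ^ p ≤ (max t 0) ^ p :=
    Real.rpow_le_rpow (by positivity) (min_le_right _ _) hp
  have h3 : Real.exp (-lam * max t 0) ≤ Real.exp (-(lam / 2) * max t 0) := by
    rw [Real.exp_le_exp]; nlinarith
  have h4 : Real.exp (-lam * max t 0) ≤ 1 := by
    rw [Real.exp_le_one_iff]; nlinarith
  unfold om
  rw [add_mul]
  have h5 : (min 1 (max t 0)) ^ p * Real.exp (-lam * max t 0)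
      ≤ (max t 0) ^ p * Real.exp (-(lam / 2) * max t 0) := by gcongr
  have h6 : η * Real.exp (-lam * max t 0) ≤ η * 1 := by gcongr
  linarith

lemma norm_duh_const_le {lam : ℝ} (hl : 0 < lam) (c : ℂ) (t : ℝ) :
    ‖duh lam (fun _ => c) t‖ ≤ 2 / lam * ‖c‖ := by
  have h1 := norm_duh_le lam ‖c‖ (g := fun _ => c) (f := fun _ => 1) continuous_const
    (fun s => by simp) t
  have h2 := singular_duhamel (t := max t 0) hl le_rfl zero_lt_one (le_max_right _ _)
  simp only [neg_zero, Real.rpow_zero, zero_sub, Real.rpow_neg_one] at h2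
  refine h1.trans ?_
  calc _ ≤ ‖c‖ * ((1 + 1 / (1 - 0)) * lam⁻¹) := by gcongr
    _ = _ := by norm_num; ring

lemma dataFun_bound {κ γ : ℝ} (hκ : 0 < κ) (hp : 0 ≤ p) (hp1 : p ≤ 1)
    (hη : 0 < η) (hη1 : η ≤ 1) (θ₀ S : TorusCoeffs d) (k : Fin d → ℤ) (t : ℝ) :
    ‖dataFun κ γ p η τ θ₀ S k t‖ ≤ dataBound κ γ p η τ θ₀ S k := by
  by_cases hk : k = 0
  · subst hk; simp [dataFun, dataBound, wt_zero]
  have hk0 : 0 < freqNorm k := lt_of_lt_of_le one_pos (one_le_freqNorm hk)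
  have hl : 0 < κ * freqNorm k ^ γ := by positivity
  have ho : 0 < om p η t := lt_of_lt_of_le hη (om_ge p η t)
  have hw := wt_pos τ hk
  have h1 := om_exp_le hl hp hp1 hη t
  have h2 := norm_duh_const_le hl (S k) t
  have h3 := om_le (t := t) hp hη1
  rw [dataFun, norm_mul, Complex.norm_real, Real.norm_eq_abs, abs_of_pos (mul_pos hw ho), dataBound,
    mul_assoc]
  gcongr
  set lam := κ * freqNorm k ^ γ
  calc om p η t * ‖(Real.exp (-lam * max t 0) : ℂ) * θ₀ k + duh lam (fun _ => S k) t‖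
      ≤ om p η t * (Real.exp (-lam * max t 0) * ‖θ₀ k‖ + 2 / lam * ‖S k‖) := by
        gcongr
        refine (norm_add_le _ _).trans ?_
        rw [norm_mul, Complex.norm_real, Real.norm_eq_abs, abs_of_pos (Real.exp_pos _)]
        gcongr
    _ = (om p η t * Real.exp (-lam * max t 0)) * ‖θ₀ k‖ + om p η t * (2 / lam * ‖S k‖) := by ring
    _ ≤ (2 * lam ^ (-p) + η) * ‖θ₀ k‖ + 2 * (2 / lam * ‖S k‖) := by gcongr
    _ = _ := by ring

lemma dataFun_cont (κ γ : ℝ) (hp : 0 ≤ p) (θ₀ S : TorusCoeffs d) (k : Fin d → ℤ) :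
    Continuous (dataFun κ γ p η τ θ₀ S k) := by
  have h1 := duh_cont (κ * freqNorm k ^ γ) (g := fun _ => S k) continuous_const
  have h2 := om_cont hp η
  unfold dataFun
  fun_prop

lemma gevrey_of_th (hη : 0 < η) (x : XS d) (t : ℝ) : InGevrey 1 0 τ (th p η τ x t) := by
  have h1 : Summable fun k => (η⁻¹ ^ 2 * ‖x‖) * ‖x k‖ := (XS_summable x).mul_left _
  refine h1.of_nonneg_of_le (fun k => by have := freqNorm_nonneg k; positivity) fun k => ?_
  by_cases hk : k = 0
  · subst hk
    have : th p η τ x t 0 = 0 := by simp [th, wt_zero]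
    rw [this]; simp; positivity
  have hk1 := one_le_freqNorm hk
  have ho : 0 < om p η t := lt_of_lt_of_le hη (om_ge p η t)
  have h2 := th_bound (p := p) τ hη x t k
  have h3 : Real.exp (τ * freqNorm k) * ‖th p η τ x t k‖ ≤ η⁻¹ * ‖x k‖ := by
    calc _ ≤ Real.exp (τ * freqNorm k) * (freqNorm k * ‖th p η τ x t k‖) := by
          gcongr
          exact le_mul_of_one_le_left (norm_nonneg _) hk1
      _ ≤ Real.exp (τ * freqNorm k) * (Real.exp (-τ * freqNorm k) * (om p η t)⁻¹ * ‖x k‖) := by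
          gcongr
      _ = (om p η t)⁻¹ * ‖x k‖ := by
          rw [← mul_assoc, ← mul_assoc, ← Real.exp_add]; simp
      _ ≤ _ := by
          gcongr
          exact om_ge p η t
  have h4 : ‖x k‖ ≤ ‖x‖ := lp.norm_apply_le_norm (by norm_num) x k
  have h5 : freqNorm k ^ (2 * (0:ℝ)) * Real.exp (2 * τ * freqNorm k ^ (1:ℝ)) * ‖th p η τ x t k‖ ^ 2
      = (Real.exp (τ * freqNorm k) * ‖th p η τ x t k‖) ^ 2 := by
    rw [mul_zero, Real.rpow_zero, Real.rpow_one, one_mul, mul_pow, ← Real.exp_nat_mul]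
    congr 2; push_cast; ring
  rw [h5]
  calc _ ≤ (η⁻¹ * ‖x k‖) ^ 2 := by gcongr
    _ = η⁻¹ ^ 2 * ‖x k‖ * ‖x k‖ := by ring
    _ ≤ _ := by gcongr

lemma solve (hC₀ : 0 < C₀) (hT : SymbolAssumptions0 d T C₀) {κ γ : ℝ} (hκ : 0 < κ)
    (hγ : 1 ≤ γ) (hp : 0 ≤ p) (hp1 : p ≤ 1) (hpγ : γ * (p - 1) ≤ -1) {C : ℝ} (hC : 0 < C)
    (hη : 0 < η) (hη1 : η ≤ 1) (hτ : 0 < τ)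
    (hCe : ∀ lam ≥ κ, ∀ t ≥ (0:ℝ),
      om p η t * ∫ s in (0:ℝ)..t, Real.exp (-lam * (t - s)) * (om p η s) ^ (-2 : ℝ)
        ≤ C * lam ^ (p - 1))
    (θ₀ S : TorusCoeffs d) (hθ₀ : MeanZero θ₀) (hS : MeanZero S)
    (hs : Summable (dataBound κ γ p η τ θ₀ S))
    (hsmall : 8 * (d * d * C₀ * C * κ ^ (p - 1) + 1) * ∑' k, dataBound κ γ p η τ θ₀ S k ≤ 1) :
    ∃ θ : ℝ → TorusCoeffs d, IsSolutionOn T κ γ S θ₀ θ (Set.Ici 0) ∧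
      ∀ t ≥ (0:ℝ), ∃ τ > (0:ℝ), InGevrey 1 0 τ (θ t) := by
  obtain ⟨y₀, hy1, hy2⟩ := XS_mk (dataFun κ γ p η τ θ₀ S) (dataFun_cont κ γ hp θ₀ S) _ hs
    (dataFun_bound hκ hp hp1 hη hη1 θ₀ S)
  obtain ⟨x, hx⟩ := exists_mild hC₀ hT hκ hγ hp hpγ hC hη hτ.le hCe y₀ (by
    refine le_trans ?_ hsmall
    gcongr)
  let θ : ℝ → TorusCoeffs d := fun t k => if k = 0 then 0 else
    Complex.exp (-((κ * freqNorm k ^ γ : ℝ) : ℂ) * t) * (θ₀ k +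
      ∫ s in (0:ℝ)..t, (Real.exp ((κ * freqNorm k ^ γ) * s) : ℂ) * (S k - nl T p η τ x x k s))
  have hnl := nl_cont (p := p) hC₀ hT hp hη hτ.le x x
  have heq : ∀ t ≥ (0:ℝ), θ t = th p η τ x t := by
    intro t ht
    funext k
    by_cases hk : k = 0
    · subst hk; simp [θ, th, wt_zero]
    simp only [θ, if_neg hk, th]
    have ho : 0 < om p η t := lt_of_lt_of_le hη (om_ge p η t)
    have hne : ((wt τ k * om p η t : ℝ) : ℂ) ≠ 0 := by
      exact_mod_cast (mul_pos (wt_pos τ hk) ho).ne'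
    rw [eq_div_iff hne, hx k t, hy1, dataFun, Bf, ← mul_sub, mul_comm]
    congr 1
    rw [add_sub_assoc, ← duh_sub _ continuous_const (hnl k), duh_eq, max_eq_left ht, mul_add]
    have he : ((Real.exp (-(κ * freqNorm k ^ γ) * t) : ℝ) : ℂ)
        = Complex.exp (-((κ * freqNorm k ^ γ : ℝ) : ℂ) * t) := by
      rw [Complex.ofReal_exp]; push_cast; rfl
    rw [he]
  refine ⟨θ, ⟨?_, ?_⟩, fun t ht => ⟨τ, hτ, by rw [heq t ht]; exact gevrey_of_th hη x t⟩⟩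
  · funext k
    by_cases hk : k = 0
    · subst hk; simp only [θ, if_true]; exact hθ₀.symm
    · simp [θ, hk]
  · intro k t ht
    rw [heq t ht]
    by_cases hk : k = 0
    · subst hk
      have h1 : (fun s => θ s 0) = fun _ => 0 := by funext s; simp [θ]
      have h2 : S 0 = 0 := hS
      have h3 : th p η τ x t 0 = 0 := by simp [th, wt_zero]
      rw [h1, advection_zero hT, h2, h3]
      simpa using hasDerivAt_const t (0:ℂ)
    · have hcont : Continuous fun s : ℝ =>
          (Real.exp ((κ * freqNorm k ^ γ) * s) : ℂ) * (S k - nl T p η τ x x k s) := by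
        have := hnl k
        fun_prop
      have h1 := intervalIntegral.integral_hasDerivAt_right
        (hcont.intervalIntegrable 0 t) (hcont.stronglyMeasurableAtFilter _ _) hcont.continuousAt
      have h2 : HasDerivAt (fun s : ℝ => Complex.exp (-((κ * freqNorm k ^ γ : ℝ) : ℂ) * s))
          (Complex.exp (-((κ * freqNorm k ^ γ : ℝ) : ℂ) * t) * (-((κ * freqNorm k ^ γ : ℝ) : ℂ))) t := by
        have h3 : HasDerivAt (fun s : ℝ => (s : ℂ)) 1 t := Complex.ofRealCLM.hasDerivAt
        have h4 := (h3.const_mul (-((κ * freqNorm k ^ γ : ℝ) : ℂ))).cexp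
        simpa using h4
      have h5 := h2.mul (h1.const_add (θ₀ k))
      have h6 : (fun s => θ s k) = fun s : ℝ =>
          Complex.exp (-((κ * freqNorm k ^ γ : ℝ) : ℂ) * s) * (θ₀ k +
          ∫ r in (0:ℝ)..s, (Real.exp ((κ * freqNorm k ^ γ) * r) : ℂ) *
            (S k - nl T p η τ x x k r)) := by
        funext s; simp only [θ, if_neg hk]
      rw [h6]
      refine h5.congr_deriv ?_
      have h7 : th p η τ x t k = Complex.exp (-((κ * freqNorm k ^ γ : ℝ) : ℂ) * t) * (θ₀ k +
          ∫ r in (0:ℝ)..t, (Real.exp ((κ * freqNorm k ^ γ) * r) : ℂ) *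
            (S k - nl T p η τ x x k r)) := by
        rw [← heq t ht]; simp only [θ, if_neg hk]
      have h8 : Complex.exp (-((κ * freqNorm k ^ γ : ℝ) : ℂ) * t) *
          (Real.exp ((κ * freqNorm k ^ γ) * t) : ℂ) = 1 := by
        rw [Complex.ofReal_exp, ← Complex.exp_add]; simp
      have h9 : advection (velocity T (th p η τ x t)) (th p η τ x t) k = nl T p η τ x x k t := rfl
      rw [h9, h7]
      linear_combination (S k - nl T p η τ x x k t) * h8

end ActiveScalar

namespace ActiveScalar
variable {d : ℕ}

lemma summable_sq' {ι : Type*} {f : ι → ℝ} (hf0 : ∀ i, 0 ≤ f i) (hf : Summable f) :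
    Summable fun i => f i ^ 2 := by
  refine (hf.mul_left (∑' i, f i)).of_nonneg_of_le (fun i => sq_nonneg _) fun i => ?_
  have := hf.le_tsum i fun j _ => hf0 j
  rw [sq]
  exact mul_le_mul_of_nonneg_right this (hf0 i)

lemma exists_rpow_le_exp (r : ℝ) {c : ℝ} (hc : 0 < c) :
    ∃ K > (0:ℝ), ∀ x ≥ (1:ℝ), x ^ r ≤ K * Real.exp (c * x) := by
  obtain ⟨n, hn⟩ := exists_nat_ge r
  refine ⟨n.factorial / c ^ n, by positivity, fun x hx => ?_⟩
  have h0 : 0 ≤ x := by linarith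
  have h1 := Real.pow_div_factorial_le_exp (c * x) (by positivity) n
  have h2 : x ^ r ≤ x ^ n := by
    rw [← Real.rpow_natCast]; exact Real.rpow_le_rpow_of_exponent_le hx hn
  refine h2.trans ?_
  rw [mul_pow, div_le_iff₀ (by positivity)] at h1
  rw [div_mul_eq_mul_div, le_div_iff₀ (by positivity)]
  linarith

lemma gev_summable {f : TorusCoeffs d} (hf : f 0 = 0) {τa : ℝ} (h : InGevrey 1 0 τa f) (s : ℝ)
    {τ : ℝ} (hτ : τ < τa) :
    Summable fun k => freqNorm k ^ s * Real.exp (τ * freqNorm k) * ‖f k‖ := by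
  have hterm : ∀ k : Fin d → ℤ,
      freqNorm k ^ (2 * (0:ℝ)) * Real.exp (2 * τa * freqNorm k ^ (1:ℝ)) * ‖f k‖ ^ 2
      = (Real.exp (τa * freqNorm k) * ‖f k‖) ^ 2 := by
    intro k
    rw [mul_zero, Real.rpow_zero, Real.rpow_one, one_mul, mul_pow, ← Real.exp_nat_mul]
    congr 2; push_cast; ring
  have h1 : Summable fun k => (Real.exp (τa * freqNorm k) * ‖f k‖) ^ 2 := by
    unfold InGevrey at h
    simpa only [hterm] using h
  set G := Real.sqrt (∑' k, (Real.exp (τa * freqNorm k) * ‖f k‖) ^ 2)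
  have hG : ∀ k, Real.exp (τa * freqNorm k) * ‖f k‖ ≤ G := fun k =>
    Real.le_sqrt_of_sq_le (h1.le_tsum k fun j _ => sq_nonneg _)
  obtain ⟨K, hK, hKb⟩ := exists_rpow_le_exp (s + (d + 1)) (sub_pos.2 hτ)
  have hz : Summable fun k : Fin d → ℤ => freqNorm k ^ (-((d:ℝ) + 1)) :=
    summable_freqNorm_rpow (by linarith)
  refine (hz.mul_left (K * G)).of_nonneg_of_le
    (fun k => by have := freqNorm_nonneg k; positivity) fun k => ?_
  by_cases hk : k = 0
  · subst hk
    rw [hf]; simp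
    have := Real.rpow_nonneg (le_refl (0:ℝ)) (-1 + -(d:ℝ))
    have hG0 : 0 ≤ G := Real.sqrt_nonneg _
    positivity
  have hk1 := one_le_freqNorm hk
  have hk0 : 0 < freqNorm k := by linarith
  have h2 := hKb _ hk1
  have h3 : freqNorm k ^ s = freqNorm k ^ (s + (d + 1)) * freqNorm k ^ (-((d:ℝ) + 1)) := by
    rw [← Real.rpow_add hk0]; ring_nf
  rw [h3]
  calc _ ≤ (K * Real.exp ((τa - τ) * freqNorm k)) * freqNorm k ^ (-((d:ℝ) + 1)) *
        Real.exp (τ * freqNorm k) * ‖f k‖ := by gcongr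
    _ = K * ((Real.exp ((τa - τ) * freqNorm k) * Real.exp (τ * freqNorm k)) * ‖f k‖) *
        freqNorm k ^ (-((d:ℝ) + 1)) := by ring
    _ = K * (Real.exp (τa * freqNorm k) * ‖f k‖) * freqNorm k ^ (-((d:ℝ) + 1)) := by
        rw [← Real.exp_add]; ring_nf
    _ ≤ _ := by gcongr; exact hG k

lemma gev_summable_sq {f : TorusCoeffs d} (hf : f 0 = 0) {τa : ℝ} (hτa : 0 < τa)
    (h : InGevrey 1 0 τa f) (a : ℝ) :
    Summable fun k => freqNorm k ^ (2 * a) * ‖f k‖ ^ 2 := by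
  have h1 := gev_summable hf h a hτa
  have h2 := summable_sq' (fun k => by have := freqNorm_nonneg k; positivity) h1
  refine h2.congr fun k => ?_
  rw [zero_mul, Real.exp_zero, mul_one, mul_pow]
  congr 1
  rw [← Real.rpow_natCast, ← Real.rpow_mul (freqNorm_nonneg k)]
  congr 1; push_cast; ring

lemma sob_bound {f : TorusCoeffs d} (hf : f 0 = 0) {τa : ℝ} (hτa : 0 < τa)
    (h : InGevrey 1 0 τa f) {a : ℝ} (ha : 0 ≤ a) :
    ∑' k, freqNorm k ^ (2 * a) * ‖f k‖ ^ 2 ≤ sobolevNormSq a f := by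
  have h1 := gev_summable_sq hf hτa h a
  have hpow : ∀ k : Fin d → ℤ, freqNorm k ^ (2 * a) = (freqNorm k ^ 2) ^ a := fun k => by
    rw [← Real.rpow_natCast, ← Real.rpow_mul (freqNorm_nonneg k)]; norm_num
  refine h1.tsum_le_tsum (fun k => ?_) ?_
  · rw [hpow]
    gcongr
    linarith
  · refine (h1.mul_left (2 ^ a)).of_nonneg_of_le (fun k => by positivity) fun k => ?_
    by_cases hk : k = 0
    · subst hk; rw [hf]; simp
    have hk1 := one_le_freqNorm hk
    rw [← mul_assoc, hpow, ← Real.mul_rpow (by norm_num) (by positivity)]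
    gcongr
    nlinarith

lemma emb_small {a σ s : ℝ} (hs : s + σ ≤ a) (hσ : (d:ℝ) < 2 * σ) {r : ℝ} (hr : 0 < r) :
    ∃ ε₀ > (0:ℝ), ∀ f : TorusCoeffs d, f 0 = 0 →
      (Summable fun k => freqNorm k ^ (2 * a) * ‖f k‖ ^ 2) →
      ∑' k, freqNorm k ^ (2 * a) * ‖f k‖ ^ 2 ≤ ε₀ →
      ∑' k, freqNorm k ^ s * ‖f k‖ ≤ r := by
  have hz : Summable fun k : Fin d → ℤ => freqNorm k ^ (-(2 * σ)) :=
    summable_freqNorm_rpow (by linarith)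
  set Z := ∑' k : Fin d → ℤ, freqNorm k ^ (-(2 * σ)) with hZ
  have hZ0 : 0 ≤ Z := tsum_nonneg fun k => Real.rpow_nonneg (freqNorm_nonneg k) _
  set δ := r / (2 * (Z + 1)) with hδ
  have hδ0 : 0 < δ := by positivity
  refine ⟨r * δ / 2, by positivity, fun f hf hsum hle => ?_⟩
  have hpt : ∀ k, freqNorm k ^ s * ‖f k‖ ≤
      δ * freqNorm k ^ (-(2 * σ)) + δ⁻¹ * (freqNorm k ^ (2 * a) * ‖f k‖ ^ 2) := by
    intro k
    by_cases hk : k = 0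
    · subst hk; rw [hf]; simp
      have := Real.rpow_nonneg (le_refl (0:ℝ)) (-(2 * σ))
      positivity
    have hk1 := one_le_freqNorm hk
    have hk0 : 0 < freqNorm k := by linarith
    set u := freqNorm k ^ (-σ)
    set v := freqNorm k ^ a * ‖f k‖
    have e1 : freqNorm k ^ s * ‖f k‖ ≤ u * v := by
      rw [← mul_assoc, ← Real.rpow_add hk0]
      gcongr
      linarith
    have e2 : freqNorm k ^ (-(2 * σ)) = u ^ 2 := by
      rw [← Real.rpow_natCast, ← Real.rpow_mul hk0.le]; congr 1; push_cast; ring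
    have e3 : freqNorm k ^ (2 * a) * ‖f k‖ ^ 2 = v ^ 2 := by
      rw [mul_pow, ← Real.rpow_natCast (freqNorm k ^ a), ← Real.rpow_mul hk0.le]
      congr 2; push_cast; ring
    rw [e2, e3]
    refine e1.trans ?_
    have h4 : 0 ≤ δ⁻¹ * (δ * u - v) ^ 2 := by positivity
    have h5 : δ⁻¹ * (δ * u - v) ^ 2 = δ * u ^ 2 - 2 * (u * v) + δ⁻¹ * v ^ 2 := by
      field_simp; ring
    have h6 : 0 ≤ δ * u ^ 2 := by positivity
    have h7 : 0 ≤ δ⁻¹ * v ^ 2 := by positivity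
    linarith
  have hsum2 := (hz.mul_left δ).add (hsum.mul_left δ⁻¹)
  have hsum1 : Summable fun k => freqNorm k ^ s * ‖f k‖ :=
    hsum2.of_nonneg_of_le (fun k => by have := freqNorm_nonneg k; positivity) hpt
  have h1 := hsum1.tsum_le_tsum hpt hsum2
  rw [(hz.mul_left δ).tsum_add (hsum.mul_left δ⁻¹), tsum_mul_left, tsum_mul_left, ← hZ] at h1
  have h2 : δ * Z ≤ r / 2 := by
    rw [hδ, div_mul_eq_mul_div, div_le_div_iff₀ (by positivity) (by norm_num)]
    nlinarith
  have h3 : δ⁻¹ * ∑' k, freqNorm k ^ (2 * a) * ‖f k‖ ^ 2 ≤ δ⁻¹ * (r * δ / 2) := by gcongr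
  have h4 : δ⁻¹ * (r * δ / 2) = r / 2 := by field_simp
  linarith

lemma tau_small {f : TorusCoeffs d} (hf : f 0 = 0) {τa : ℝ} (hτa : 0 < τa)
    (h : InGevrey 1 0 τa f) (s : ℝ) {r r' : ℝ} (hr : ∑' k, freqNorm k ^ s * ‖f k‖ ≤ r)
    (hrr : r < r') :
    ∀ᶠ τ in nhds (0:ℝ), ∑' k, freqNorm k ^ s * Real.exp (τ * freqNorm k) * ‖f k‖ ≤ r' := by
  have hb := gev_summable hf h s (half_lt_self hτa)
  have hlim : Filter.Tendsto
      (fun τ : ℝ => ∑' k, freqNorm k ^ s * Real.exp (τ * freqNorm k) * ‖f k‖) (nhds 0)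
      (nhds (∑' k, freqNorm k ^ s * ‖f k‖)) := by
    refine tendsto_tsum_of_dominated_convergence hb (fun k => ?_) ?_
    · have : Continuous fun τ : ℝ => freqNorm k ^ s * Real.exp (τ * freqNorm k) * ‖f k‖ := by
        fun_prop
      have h2 := this.tendsto 0
      simpa using h2
    · filter_upwards [eventually_lt_nhds (half_pos hτa)] with τ hτ k
      have hk := freqNorm_nonneg k
      rw [Real.norm_of_nonneg (by positivity)]
      gcongr
  filter_upwards [hlim.eventually_lt_const (lt_of_le_of_lt hr hrr)] with τ hτ using hτ.le

end ActiveScalar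

namespace ActiveScalar

lemma dataBound_eq {d : ℕ} {κ γ p η τ : ℝ} (hκ : 0 < κ) {θ₀ S : TorusCoeffs d}
    (hθ₀ : θ₀ 0 = 0) (hS : S 0 = 0) (k : Fin d → ℤ) :
    dataBound κ γ p η τ θ₀ S k =
      2 * κ ^ (-p) * (freqNorm k ^ (1 - p * γ) * Real.exp (τ * freqNorm k) * ‖θ₀ k‖)
      + η * (freqNorm k ^ (1:ℝ) * Real.exp (τ * freqNorm k) * ‖θ₀ k‖)
      + 4 / κ * (freqNorm k ^ (1 - γ) * Real.exp (τ * freqNorm k) * ‖S k‖) := by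
  by_cases hk : k = 0
  · subst hk; simp [dataBound, hθ₀, hS]
  have hk0 : 0 < freqNorm k := lt_of_lt_of_le one_pos (one_le_freqNorm hk)
  have h1 : freqNorm k ^ (1 - p * γ) = freqNorm k * (freqNorm k ^ γ) ^ (-p) := by
    rw [← Real.rpow_mul hk0.le, sub_eq_add_neg, Real.rpow_add hk0, Real.rpow_one]
    congr 2; ring
  have h2 : freqNorm k ^ (1 - γ) = freqNorm k / freqNorm k ^ γ := by
    rw [Real.rpow_sub hk0, Real.rpow_one]
  have h3 : 0 < freqNorm k ^ γ := Real.rpow_pos_of_pos hk0 _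
  rw [dataBound, wt, Real.mul_rpow hκ.le h3.le, h1, h2, Real.rpow_one]
  field_simp

lemma exponents {d : ℕ} (hd : d = 2 ∨ d = 3) {γ α : ℝ} (hγ : γ ∈ Set.Icc (1:ℝ) 2)
    (hα : ((d:ℝ) + 2)/2 + (1 - γ) < α) :
    ∃ p σ : ℝ, 0 ≤ p ∧ p < 1 / 2 ∧ γ * (p - 1) ≤ -1 ∧ (d:ℝ) < 2 * σ ∧ 1 - p * γ + σ ≤ α ∧
      1 - γ + σ ≤ α - γ / 2 ∧ 0 ≤ α - γ / 2 := by
  obtain ⟨h1, h2⟩ := hγ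
  have hd2 : (2:ℝ) ≤ d := by rcases hd with h | h <;> subst h <;> norm_num
  have hg : 0 < γ := by linarith
  set δ := α - (((d:ℝ) + 2)/2 + (1 - γ)) with hδ
  have hδ0 : 0 < δ := by linarith
  set q := γ - 1 - δ / 2 with hq
  set p := max 0 (q / γ) with hp
  have hp0 : 0 ≤ p := le_max_left _ _
  have hpq : q ≤ p * γ := by
    have : q / γ ≤ p := le_max_right _ _
    rwa [div_le_iff₀ hg] at this
  have hcase : p * γ = 0 ∨ p * γ = q := by
    rcases le_total (q / γ) 0 with h | h
    · left; rw [hp, max_eq_left h, zero_mul]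
    · right; rw [hp, max_eq_right h]; field_simp
  refine ⟨p, d / 2 + δ / 2, hp0, ?_, ?_, by linarith, by linarith, by linarith, by linarith⟩
  · by_contra hcon
    push Not at hcon
    have : γ / 2 ≤ p * γ := by nlinarith
    rcases hcase with h | h <;> linarith
  · rcases hcase with h | h <;> nlinarith

lemma main_aux (d : ℕ) (hd : d = 2 ∨ d = 3)
    (T₀ : Fin d → Fin d → (Fin d → ℤ) → ℂ) (C₀ : ℝ) (hC₀ : 0 < C₀)
    (hT : SymbolAssumptions0 d T₀ C₀)
    (κ γ : ℝ) (hκ : 0 < κ) (hγ : γ ∈ Set.Icc (1:ℝ) 2)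
    (α : ℝ) (hα : ((d:ℝ) + 2)/2 + (1 - γ) < α) :
    ∃ ε > (0:ℝ),
      ∀ θ₀ S : TorusCoeffs d, MeanZero θ₀ → MeanZero S →
        (∃ τa > (0:ℝ), InGevrey 1 0 τa θ₀) → (∃ τa > (0:ℝ), InGevrey 1 0 τa S) →
        (lambdaNormSq α θ₀ + (2/κ^2) * sobolevNormSq (α - γ/2) S ≤ ε) →
        ∃ θ : ℝ → TorusCoeffs d,
          IsSolutionOn T₀ κ γ S θ₀ θ (Set.Ici 0) ∧
          ∀ t ≥ (0:ℝ), ∃ τ > (0:ℝ), InGevrey 1 0 τ (θ t) := by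
  obtain ⟨p, σ, hp, hp1, hpγ, hσ, hs1, hs2, ha⟩ := exponents hd hγ hα
  obtain ⟨C, hC, hCe⟩ := time_estimate hp hp1 hκ
  set K : ℝ := 8 * (d * d * C₀ * C * κ ^ (p - 1) + 1) with hK
  have hK0 : 0 < K := by positivity
  set A : ℝ := 2 * κ ^ (-p) with hA
  have hA0 : 0 < A := by positivity
  have hB0 : 0 < 4 / κ := by positivity
  set r₁ : ℝ := 1 / (6 * K * A) with hr₁
  set r₂ : ℝ := 1 / (6 * K * (4 / κ)) with hr₂
  have hr₁0 : 0 < r₁ := by positivity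
  have hr₂0 : 0 < r₂ := by positivity
  obtain ⟨ε₁, hε₁, h₁⟩ := emb_small (d := d) hs1 hσ hr₁0
  obtain ⟨ε₂, hε₂, h₂⟩ := emb_small (d := d) hs2 hσ hr₂0
  refine ⟨min ε₁ (2 / κ ^ 2 * ε₂), by positivity, ?_⟩
  rintro θ₀ S hθ hS ⟨τ₁, hτ₁, hg₁⟩ ⟨τ₂, hτ₂, hg₂⟩ hsm
  have hl0 : 0 ≤ lambdaNormSq α θ₀ := tsum_nonneg fun k => by
    have := freqNorm_nonneg k
    positivity
  have hs0 : 0 ≤ sobolevNormSq (α - γ/2) S := tsum_nonneg fun k => by positivity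
  have hk2 : 0 < 2 / κ ^ 2 := by positivity
  have hb1 : lambdaNormSq α θ₀ ≤ ε₁ := by
    have := mul_nonneg hk2.le hs0
    linarith [min_le_left ε₁ (2 / κ ^ 2 * ε₂)]
  have hb2 : sobolevNormSq (α - γ/2) S ≤ ε₂ := by
    have : 2 / κ ^ 2 * sobolevNormSq (α - γ/2) S ≤ 2 / κ ^ 2 * ε₂ := by
      linarith [min_le_right ε₁ (2 / κ ^ 2 * ε₂)]
    exact le_of_mul_le_mul_left this hk2
  have e1 := h₁ θ₀ hθ (gev_summable_sq hθ hτ₁ hg₁ α) hb1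
  have e2 := h₂ S hS (gev_summable_sq hS hτ₂ hg₂ _) ((sob_bound hS hτ₂ hg₂ ha).trans hb2)
  have t1 := tau_small hθ hτ₁ hg₁ _ e1 (show r₁ < 2 * r₁ by linarith)
  have t2 := tau_small hS hτ₂ hg₂ _ e2 (show r₂ < 2 * r₂ by linarith)
  have hev : ∀ᶠ τ in nhdsWithin (0:ℝ) (Set.Ioi 0), 0 < τ ∧ τ < τ₁ ∧ τ < τ₂ ∧
      ∑' k, freqNorm k ^ (1 - p * γ) * Real.exp (τ * freqNorm k) * ‖θ₀ k‖ ≤ 2 * r₁ ∧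
      ∑' k, freqNorm k ^ (1 - γ) * Real.exp (τ * freqNorm k) * ‖S k‖ ≤ 2 * r₂ := by
    filter_upwards [self_mem_nhdsWithin, nhdsWithin_le_nhds t1, nhdsWithin_le_nhds t2,
      nhdsWithin_le_nhds (Iio_mem_nhds hτ₁), nhdsWithin_le_nhds (Iio_mem_nhds hτ₂)]
      with τ a b c e f
    exact ⟨a, e, f, b, c⟩
  obtain ⟨τ, hτ, hττ₁, hττ₂, f1, f2⟩ := hev.exists
  have s1 := gev_summable hθ hg₁ (1 - p * γ) hττ₁
  have s2 := gev_summable hθ hg₁ 1 hττ₁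
  have s3 := gev_summable hS hg₂ (1 - γ) hττ₂
  set D := ∑' k, freqNorm k ^ (1:ℝ) * Real.exp (τ * freqNorm k) * ‖θ₀ k‖ with hD
  have hD0 : 0 ≤ D := tsum_nonneg fun k => by
    have := freqNorm_nonneg k
    positivity
  set η : ℝ := min 1 (1 / (3 * K * (D + 1))) with hη
  have hη0 : 0 < η := by positivity
  have hηD : η * D ≤ 1 / (3 * K) := by
    calc η * D ≤ 1 / (3 * K * (D + 1)) * (D + 1) := by
          gcongr
          · exact min_le_right _ _
          · linarith
      _ = 1 / (3 * K) := by field_simp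
  have hfun : dataBound κ γ p η τ θ₀ S = fun k =>
      A * (freqNorm k ^ (1 - p * γ) * Real.exp (τ * freqNorm k) * ‖θ₀ k‖)
      + η * (freqNorm k ^ (1:ℝ) * Real.exp (τ * freqNorm k) * ‖θ₀ k‖)
      + 4 / κ * (freqNorm k ^ (1 - γ) * Real.exp (τ * freqNorm k) * ‖S k‖) :=
    funext fun k => dataBound_eq hκ hθ hS k
  refine solve hC₀ hT hκ hγ.1 hp (by linarith) hpγ hC hη0 (min_le_left _ _) hτ
    (hCe η hη0) θ₀ S hθ hS ?_ ?_
  · rw [hfun]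
    exact ((s1.mul_left _).add (s2.mul_left _)).add (s3.mul_left _)
  · rw [hfun, ((s1.mul_left _).add (s2.mul_left _)).tsum_add (s3.mul_left _),
      (s1.mul_left _).tsum_add (s2.mul_left _), tsum_mul_left, tsum_mul_left, tsum_mul_left,
      ← hD, ← hK]
    have g1 := mul_le_mul_of_nonneg_left f1 hA0.le
    have g2 := mul_le_mul_of_nonneg_left f2 hB0.le
    have g3 : A * (2 * r₁) = 1 / (3 * K) := by rw [hr₁]; field_simp; norm_num
    have g4 : 4 / κ * (2 * r₂) = 1 / (3 * K) := by rw [hr₂]; field_simp; norm_num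
    have g5 : K * (1 / (3 * K) + 1 / (3 * K) + 1 / (3 * K)) = 1 := by field_simp; norm_num
    refine le_trans (mul_le_mul_of_nonneg_left ?_ hK0.le) g5.le
    linarith

end ActiveScalar

namespace ActiveScalar

/-- Theorem: global-in-time existence of analytic solutions with small
Sobolev data, `ν = 0`, `κ > 0`, `γ ∈ [1,2]`.  With `α > (d+2)/2 + (1−γ)` and
`β = 1 − (1/α)[(d+2)/2 + (1−γ)]`, there exists `ε > 0` depending on `κ` such that if the
mean-zero analytic data satisfy
`‖θ₀‖_{L²}^β ‖θ₀‖_{H^α}^{1−β} + ‖θ₀‖_{L²}^β ‖S‖_{H^{α−γ/2}}^{1−β} ≤ ε` and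
`‖Λ^α θ₀‖²_{L²} + (2/κ²)‖S‖²_{H^{α−γ/2}} ≤ ε`, then the local analytic solution extends
to a global-in-time analytic solution. -/
theorem global_existence_analytic_small_data
    (d : ℕ) (hd : d = 2 ∨ d = 3)
    (T₀ : Fin d → Fin d → (Fin d → ℤ) → ℂ) (C₀ : ℝ) (hC₀ : 0 < C₀)
    (hT : SymbolAssumptions0 d T₀ C₀)
    (κ γ : ℝ) (hκ : 0 < κ) (hγ : γ ∈ Set.Icc (1:ℝ) 2)
    (α β : ℝ) (hα : ((d:ℝ) + 2)/2 + (1 - γ) < α)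
    (hβ : β = 1 - (1/α) * (((d:ℝ) + 2)/2 + (1 - γ))) :
    ∃ ε > (0:ℝ),
      ∀ θ₀ S : TorusCoeffs d, MeanZero θ₀ → MeanZero S →
        (∃ τa > (0:ℝ), InGevrey 1 0 τa θ₀) → (∃ τa > (0:ℝ), InGevrey 1 0 τa S) →
        (l2Norm θ₀ ^ β * sobolevNorm α θ₀ ^ (1 - β) +
          l2Norm θ₀ ^ β * sobolevNorm (α - γ/2) S ^ (1 - β) ≤ ε) →
        (lambdaNormSq α θ₀ + (2/κ^2) * sobolevNormSq (α - γ/2) S ≤ ε) →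
        ∃ θ : ℝ → TorusCoeffs d,
          IsSolutionOn T₀ κ γ S θ₀ θ (Set.Ici 0) ∧
          ∀ t ≥ (0:ℝ), ∃ τ > (0:ℝ), InGevrey 1 0 τ (θ t) := by
  obtain ⟨ε, hε, h⟩ := main_aux d hd T₀ C₀ hC₀ hT κ γ hκ hγ α hα
  exact ⟨ε, hε, fun θ₀ S hθ hS h1 h2 _ h3 => h θ₀ S hθ hS h1 h2 h3⟩

end ActiveScalar
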